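/- Let Ω ⊂ ℝⁿ (n ≥ 2) be an open bounded domain, let F : 𝒮(n) → ℝ be (λ,Λ)-elliptic with F(0) = 0, let μ ∈ [0,1], let p, q, s ∈ C(Ω) be nonnegative, let a, b ∈ C(Ω) be nonnegative, and let f ∈ C(Ω) ∩ L^∞(Ω). Set ℓ_μ(z) = √(μ² + |z|²) and G_μ(x,z) = ℓ_μ(z)^{p(x)} + a(x)ℓ_μ(z)^{q(x)} + b(x)ℓ_μ(z)^{s(x)}. Let u ∈ C(Ω) be a viscosity solution of G_μ(x, Du)(μ u + F(D²u)) = f(x) in Ω. Then u is locally β₀-Hölder continuous in Ω for every β₀ ∈ (0,1); in particular, for every ball B_ρ(z₀) ⋐ Ω with ρ ∈ (0, 1/2) and every β₀ ∈ (0,1), [u]_{0,β₀;B_{ρ/2}(z₀)} ≤ c, where c depends only on n, λ, Λ, ‖u‖_{L∞(B_ρ(z₀))}, ‖f‖_{L∞(B_ρ(z₀))}, ρ and β₀ — in particular c is independent of μ and of the moduli of continuity of a, b, p, q, s. -/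

import Mathlib

open Metric Set MeasureTheory Topology

noncomputable section

abbrev En (n : ℕ) : Type := EuclideanSpace ℝ (Fin n)
abbrev Mat (n : ℕ) : Type := Matrix (Fin n) (Fin n) ℝ

/-- `F : 𝒮(n) → ℝ` is uniformly `(λ,Λ)`-elliptic:
for all symmetric `A, B` with `B` positive semidefinite,
`λ·tr B ≤ F A − F (A + B) ≤ Λ·tr B`. -/
def UniformlyElliptic {n : ℕ} (lam Lam : ℝ) (F : Mat n → ℝ) : Prop :=
  Continuous F ∧
    ∀ A B : Mat n, A.IsSymm → B.IsSymm → B.PosSemidef →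
      lam * B.trace ≤ F A - F (A + B) ∧ F A - F (A + B) ≤ Lam * B.trace

/-- The Hessian matrix of `φ` at `x`, in the standard basis of `ℝⁿ`. -/
def hessianMatrix {n : ℕ} (φ : En n → ℝ) (x : En n) : Mat n :=
  Matrix.of fun i j =>
    iteratedFDeriv ℝ 2 φ x ![EuclideanSpace.single i (1 : ℝ), EuclideanSpace.single j (1 : ℝ)]

/-- `w` is a viscosity subsolution of `G(x, u(x), Du, D²u) = 0` on `Ω`:
whenever a `C²` function `φ` is such that `w − φ` has a local maximum (on `Ω`) at `x₀ ∈ Ω`,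
then `G x₀ (w x₀) (Dφ x₀) (D²φ x₀) ≤ 0`. -/
def ViscSubOn {n : ℕ} (Ω : Set (En n)) (G : En n → ℝ → En n → Mat n → ℝ)
    (w : En n → ℝ) : Prop :=
  ∀ φ : En n → ℝ, ContDiff ℝ 2 φ → ∀ x₀ ∈ Ω,
    IsLocalMaxOn (fun x => w x - φ x) Ω x₀ →
      G x₀ (w x₀) (gradient φ x₀) (hessianMatrix φ x₀) ≤ 0

/-- `w` is a viscosity supersolution of `G(x, u(x), Du, D²u) = 0` on `Ω`. -/
def ViscSupOn {n : ℕ} (Ω : Set (En n)) (G : En n → ℝ → En n → Mat n → ℝ)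
    (w : En n → ℝ) : Prop :=
  ∀ φ : En n → ℝ, ContDiff ℝ 2 φ → ∀ x₀ ∈ Ω,
    IsLocalMinOn (fun x => w x - φ x) Ω x₀ →
      0 ≤ G x₀ (w x₀) (gradient φ x₀) (hessianMatrix φ x₀)

/-- viscosity solution: both a subsolution and a supersolution. -/
def ViscSolOn {n : ℕ} (Ω : Set (En n)) (G : En n → ℝ → En n → Mat n → ℝ)
    (u : En n → ℝ) : Prop :=
  ViscSubOn Ω G u ∧ ViscSupOn Ω G u

/-- `H(x, z; ξ) = |ξ+z|^p + coef(x)·|ξ+z|^e`. -/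
def Hfun {n : ℕ} (p e : ℝ) (coef : En n → ℝ) (ξ x z : En n) : ℝ :=
  ‖ξ + z‖ ^ p + coef x * ‖ξ + z‖ ^ e

/-- The switched exponent `p_v(x) = p⁺·1_{v>0}(x) + p⁻·1_{v<0}(x)`. -/
def pSwitch {n : ℕ} (pp pm : ℝ) (v : En n → ℝ) (x : En n) : ℝ :=
  pp * Set.indicator {y | 0 < v y} (fun _ => (1 : ℝ)) x
    + pm * Set.indicator {y | v y < 0} (fun _ => (1 : ℝ)) x

/-- The transmission operator
`[|ξ+z|^{p_v(x)} + a(x)1_{v>0}|ξ+z|^q + b(x)1_{v<0}|ξ+z|^s]·F(X) − f(x)`. -/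
def transOp {n : ℕ} (F : Mat n → ℝ) (pp pm q s : ℝ) (a b f v : En n → ℝ) (ξ : En n) :
    En n → ℝ → En n → Mat n → ℝ :=
  fun x _ z X =>
    (‖ξ + z‖ ^ pSwitch pp pm v x
        + a x * Set.indicator {y | 0 < v y} (fun _ => (1 : ℝ)) x * ‖ξ + z‖ ^ q
        + b x * Set.indicator {y | v y < 0} (fun _ => (1 : ℝ)) x * ‖ξ + z‖ ^ s) * F X - f x

/-- `min{F(X), H_q(x,z;ξ)F(X), H_s(x,z;ξ)F(X)} − rhs(x)`. -/
def minOp {n : ℕ} (F : Mat n → ℝ) (pp pm q s : ℝ) (a b : En n → ℝ) (ξ : En n)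
    (rhs : En n → ℝ) : En n → ℝ → En n → Mat n → ℝ :=
  fun x _ z X =>
    min (F X) (min (Hfun pp q a ξ x z * F X) (Hfun pm s b ξ x z * F X)) - rhs x

/-- `max{F(X), H_q(x,z;ξ)F(X), H_s(x,z;ξ)F(X)} − rhs(x)`. -/
def maxOp {n : ℕ} (F : Mat n → ℝ) (pp pm q s : ℝ) (a b : En n → ℝ) (ξ : En n)
    (rhs : En n → ℝ) : En n → ℝ → En n → Mat n → ℝ :=
  fun x _ z X =>
    max (F X) (max (Hfun pp q a ξ x z * F X) (Hfun pm s b ξ x z * F X)) - rhs x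

/-- Definition D: `u` is a viscosity solution of the free transmission equation
relative to the sign of `v`, with translation vector `ξ`. -/
def DefDSolution {n : ℕ} (Ω : Set (En n)) (F : Mat n → ℝ) (pp pm q s : ℝ)
    (a b f : En n → ℝ) (v : En n → ℝ) (ξ : En n) (u : En n → ℝ) : Prop :=
  ViscSolOn ({x ∈ Ω | 0 < v x} ∪ {x ∈ Ω | v x < 0}) (transOp F pp pm q s a b f v ξ) u ∧
  ViscSubOn {x ∈ Ω | v x = 0} (minOp F pp pm q s a b ξ f) u ∧
  ViscSupOn {x ∈ Ω | v x = 0} (maxOp F pp pm q s a b ξ f) u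

/-- Uniform exterior sphere condition for `Ω`. -/
def UnifExtSphere {n : ℕ} (Ω : Set (En n)) : Prop :=
  ∃ r : ℝ, 0 < r ∧ ∀ y ∈ frontier Ω, ∃ x : En n,
    dist y x = r ∧ Metric.closedBall x r ∩ closure Ω = {y}

/-- `φ` is a smooth, nonnegative, radially symmetric mollifier supported in `B_ε(0)`
with unit mass. -/
def IsMollifier {n : ℕ} (ε : ℝ) (φ : En n → ℝ) : Prop :=
  ContDiff ℝ (⊤ : ℕ∞) φ ∧ (∀ x, 0 ≤ φ x) ∧ (∀ x y : En n, ‖x‖ = ‖y‖ → φ x = φ y) ∧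
    (∫ x, φ x) = 1 ∧ ∀ x : En n, ε ≤ ‖x‖ → φ x = 0

/-- The mollified indicator `(φε * 1_S)(x)`. -/
def smoothedChi {n : ℕ} (φε : En n → ℝ) (S : Set (En n)) (x : En n) : ℝ :=
  ∫ y, φε y * S.indicator (fun _ => (1 : ℝ)) (x - y)

/-- `ℓ_μ(z) = √(μ² + |z|²)`. -/
def ellReg {n : ℕ} (μ : ℝ) (z : En n) : ℝ := Real.sqrt (μ ^ 2 + ‖z‖ ^ 2)

/-- The regularized operator
`G_ε(x, z)·(ε·r + F(X)) − f(x)`, where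
`G_ε(x,z) = ℓ_ε(z)^{p_{ε;v}(x)} + a_{ε;v}(x) ℓ_ε(z)^q + b_{ε;v}(x) ℓ_ε(z)^s`. -/
def regOp {n : ℕ} (F : Mat n → ℝ) (ε pp pm q s : ℝ) (a b v f φε : En n → ℝ) :
    En n → ℝ → En n → Mat n → ℝ :=
  fun x r z X =>
    (ellReg ε z ^ (ε + pp * smoothedChi φε {y | 0 < v y} x + pm * smoothedChi φε {y | v y < 0} x)
        + (ε + a x * smoothedChi φε {y | 0 < v y} x) * ellReg ε z ^ q
        + (ε + b x * smoothedChi φε {y | v y < 0} x) * ellReg ε z ^ s) * (ε * r + F X) - f x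

/-- The Multi-Phase operator with variable exponents:
`[ℓ_μ(z)^{p(x)} + a(x)ℓ_μ(z)^{q(x)} + b(x)ℓ_μ(z)^{s(x)}]·(μ·r + F(X)) − f(x)`. -/
def mpOp {n : ℕ} (F : Mat n → ℝ) (μ : ℝ) (p q s a b f : En n → ℝ) :
    En n → ℝ → En n → Mat n → ℝ :=
  fun x r z X =>
    (ellReg μ z ^ p x + a x * ellReg μ z ^ q x + b x * ellReg μ z ^ s x) * (μ * r + F X) - f x

/-- Pucci maximal operator `M⁺_{λ,Λ}(A) = −Λ·tr(A⁻) − λ·tr(A⁺)`. -/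
def pucciPlus {n : ℕ} (lam Lam : ℝ) (A : Mat n) : ℝ :=
  if h : A.IsHermitian then
    -(Lam * ∑ i, min (h.eigenvalues i) 0) - lam * ∑ i, max (h.eigenvalues i) 0
  else 0

/-- Pucci minimal operator `M⁻_{λ,Λ}(A) = −Λ·tr(A⁺) − λ·tr(A⁻)`. -/
def pucciMinus {n : ℕ} (lam Lam : ℝ) (A : Mat n) : ℝ :=
  if h : A.IsHermitian then
    -(Lam * ∑ i, max (h.eigenvalues i) 0) - lam * ∑ i, min (h.eigenvalues i) 0
  else 0

/-- `u` is locally `β`-Hölder continuous on `Ω`. -/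
def LocallyHolderOn {n : ℕ} (Ω : Set (En n)) (β : ℝ) (u : En n → ℝ) : Prop :=
  ∀ x ∈ Ω, ∃ ε > 0, ∃ C : ℝ, ∀ y ∈ ball x ε ∩ Ω, ∀ z ∈ ball x ε ∩ Ω,
    |u y - u z| ≤ C * ‖y - z‖ ^ β

/-- `u ∈ C^{1,α}_loc(Ω)`: `u` is differentiable on `Ω` with locally
`α`-Hölder continuous gradient. -/
def C1HolderLocOn {n : ℕ} (Ω : Set (En n)) (α : ℝ) (u : En n → ℝ) : Prop :=
  (∀ x ∈ Ω, DifferentiableAt ℝ u x) ∧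
  ∀ x ∈ Ω, ∃ ε > 0, ∃ C : ℝ, ∀ y ∈ ball x ε ∩ Ω, ∀ z ∈ ball x ε ∩ Ω,
    ‖gradient u y - gradient u z‖ ≤ C * ‖y - z‖ ^ α

section JA
open Filter
variable {E : Type*} [NormedAddCommGroup E] [InnerProductSpace ℝ E] [FiniteDimensional ℝ E]

/-- every point has a subgradient -/
def HasSubg (f : E → ℝ) : Prop := ∀ z, ∃ ζ : E, ∀ y, f z + inner ℝ ζ (y - z) ≤ f y

lemma HasSubg.convexOn {f : E → ℝ} (hf : HasSubg f) : ConvexOn ℝ univ f := by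
  refine ⟨convex_univ, ?_⟩
  intro x _ y _ a b ha hb hab
  obtain ⟨ζ, h⟩ := hf (a • x + b • y)
  have h1 := h x
  have h2 := h y
  have e1 : x - (a • x + b • y) = b • (x - y) := by
    have : a = 1 - b := by linarith
    subst this; module
  have e2 : y - (a • x + b • y) = (-a) • (x - y) := by
    have : b = 1 - a := by linarith
    subst this; module
  rw [e1, inner_smul_right] at h1
  rw [e2, inner_smul_right] at h2
  simp only [smul_eq_mul]
  have h3 := mul_le_mul_of_nonneg_left h1 ha
  have h4 := mul_le_mul_of_nonneg_left h2 hb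
  have : (a + b) * f (a • x + b • y) = f (a • x + b • y) := by rw [hab, one_mul]
  nlinarith

lemma HasSubg.continuous {f : E → ℝ} (hf : HasSubg f) : Continuous f := by
  have := hf.convexOn.continuousOn isOpen_univ
  exact continuousOn_univ.mp this

lemma HasSubg.exists_prox {f : E → ℝ} (hf : HasSubg f) :
    ∃ J : E → E, ∀ x y, f (J x) + inner ℝ (x - J x) (y - J x) ≤ f y := by
  have key : ∀ x, ∃ m, ∀ y, f m + inner ℝ (x - m) (y - m) ≤ f y := by
    intro x
    have hc := hf.continuous
    obtain ⟨m, hm⟩ : ∃ m, ∀ y, f m + 1/2 * ‖m - x‖^2 ≤ f y + 1/2 * ‖y - x‖^2 := by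
      apply Continuous.exists_forall_le (f := fun y => f y + 1/2 * ‖y - x‖^2) (by fun_prop)
      obtain ⟨ζ, hζ⟩ := hf x
      have ht : Tendsto (fun y : E => ‖y - x‖) (cocompact E) atTop := by
        have := tendsto_dist_right_cocompact_atTop (α := E) x
        simpa [dist_eq_norm] using this
      have hq : Tendsto (fun t : ℝ => (f x - ‖ζ‖^2) + 1/4 * t^2) atTop atTop := by
        apply tendsto_atTop_add_const_left
        exact (tendsto_pow_atTop (by norm_num)).const_mul_atTop (by norm_num)
      refine tendsto_atTop_mono ?_ (hq.comp ht)
      intro y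
      have h1 := hζ y
      have h2 := abs_real_inner_le_norm ζ (y - x)
      have h3 := (abs_le.mp h2).1
      simp only [Function.comp]
      nlinarith [sq_nonneg (‖ζ‖ - 1/2 * ‖y - x‖)]
    refine ⟨m, fun y => ?_⟩
    have hconv := hf.convexOn
    have h1 : ∀ t ∈ Ioo (0:ℝ) 1, inner ℝ (x - m) (y - m) - t * (1/2 * ‖y - m‖^2) ≤ f y - f m := by
      intro t ht
      have h2 := hm (m + t • (y - m))
      have h3 := hconv.2 (mem_univ m) (mem_univ y) (sub_nonneg.mpr ht.2.le)
        ht.1.le (sub_add_cancel 1 t)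
      have e : (1 - t) • m + t • y = m + t • (y - m) := by module
      rw [e] at h3
      have e2 : m + t • (y - m) - x = (m - x) + t • (y - m) := by abel
      rw [e2, norm_add_sq_real, norm_smul, inner_smul_right] at h2
      have e3 : inner ℝ (m - x) (y - m) = - inner ℝ (x - m) (y - m) := by
        rw [← inner_neg_left, neg_sub]
      rw [e3, mul_pow, Real.norm_eq_abs, sq_abs] at h2
      simp only [smul_eq_mul] at h3
      have : t * (inner ℝ (x - m) (y - m) - t * (1/2 * ‖y - m‖^2)) ≤ t * (f y - f m) := by nlinarith
      exact le_of_mul_le_mul_left this ht.1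
    have hlim : Tendsto (fun t : ℝ => inner ℝ (x - m) (y - m) - t * (1/2 * ‖y - m‖^2)) (𝓝[>] 0)
        (𝓝 (inner ℝ (x - m) (y - m) - 0 * (1/2 * ‖y - m‖^2))) := by
      apply Tendsto.mono_left _ nhdsWithin_le_nhds
      apply Continuous.tendsto
      fun_prop
    have := le_of_tendsto hlim (b := f y - f m) (by
      filter_upwards [Ioo_mem_nhdsGT (show (0:ℝ) < 1 by norm_num)] with t ht using h1 t ht)
    linarith
  choose J hJ using key
  exact ⟨J, hJ⟩

/-- `J` is a prox map of `f`. -/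
def IsProx (f : E → ℝ) (J : E → E) : Prop :=
  ∀ x y, f (J x) + inner ℝ (x - J x) (y - J x) ≤ f y

lemma IsProx.mono {f : E → ℝ} {J : E → E} (h : IsProx f J) (x x' : E) :
    ‖J x' - J x‖^2 ≤ inner ℝ (x' - x) (J x' - J x) := by
  have h1 := h x (J x')
  have h2 := h x' (J x)
  have e : J x - J x' = -(J x' - J x) := by abel
  rw [e, inner_neg_right] at h2
  have e2 : x' - x = (J x' - J x) + (x' - J x') - (x - J x) := by abel
  rw [e2, inner_sub_left, inner_add_left, real_inner_self_eq_norm_sq]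
  linarith

lemma IsProx.lipschitz {f : E → ℝ} {J : E → E} (h : IsProx f J) : LipschitzWith 1 J := by
  apply LipschitzWith.of_dist_le_mul
  intro x' x
  rw [dist_eq_norm, dist_eq_norm, NNReal.coe_one, one_mul]
  have h1 := h.mono x x'
  have h2 := real_inner_le_norm (x' - x) (J x' - J x)
  by_contra hc
  push Not at hc
  have : 0 < ‖J x' - J x‖ := lt_of_le_of_lt (norm_nonneg _) hc
  nlinarith

lemma IsProx.eq_of_subg {f : E → ℝ} {J : E → E} (h : IsProx f J) {z ζ : E}
    (hz : ∀ y, f z + inner ℝ ζ (y - z) ≤ f y) : J (z + ζ) = z := by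
  have h1 := h (z + ζ) z
  have h2 := hz (J (z + ζ))
  set w := J (z + ζ)
  have e : z - w = -(w - z) := by abel
  have e2 : z + ζ - w = ζ - (w - z) := by abel
  rw [e2, e, inner_neg_right, inner_sub_left, real_inner_self_eq_norm_sq] at h1
  have : ‖w - z‖^2 ≤ 0 := by linarith
  have : ‖w - z‖ = 0 := by nlinarith [norm_nonneg (w - z)]
  exact sub_eq_zero.mp (norm_eq_zero.mp this)

/-- Moreau envelope -/
def envl (f : E → ℝ) (J : E → E) (x : E) : ℝ := f (J x) + 1/2 * ‖x - J x‖^2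

lemma IsProx.env_le {f : E → ℝ} {J : E → E} (h : IsProx f J) (x y : E) :
    envl f J x ≤ f y + 1/2 * ‖x - y‖^2 := by
  have h1 := h x y
  have e : x - y = (x - J x) - (y - J x) := by abel
  unfold envl
  have e2 := norm_sub_sq_real (x - J x) (y - J x)
  rw [e, e2]
  nlinarith [sq_nonneg ‖y - J x‖]

lemma IsProx.env_ge {f : E → ℝ} {J : E → E} (h : IsProx f J) (x x' : E) :
    envl f J x + inner ℝ (x - J x) (x' - x) ≤ envl f J x' := by
  have h1 := h x (J x')
  unfold envl
  have e : x' - x = (J x' - J x) + ((x' - J x') - (x - J x)) := by abel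
  have e3 : inner ℝ (x - J x) ((x' - J x') - (x - J x)) = inner ℝ (x - J x) (x' - J x')
    - ‖x - J x‖^2 := by rw [inner_sub_right, real_inner_self_eq_norm_sq]
  rw [e, inner_add_right, e3]
  have h2 := norm_sub_sq_real (x' - J x') (x - J x)
  rw [real_inner_comm] at h2
  nlinarith [sq_nonneg ‖(x' - J x') - (x - J x)‖]

lemma IsProx.env_hasFDerivAt {f : E → ℝ} {J : E → E} (h : IsProx f J) (x : E) :
    HasFDerivAt (envl f J) (innerSL ℝ (x - J x)) x := by
  rw [hasFDerivAt_iff_isLittleO_nhds_zero]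
  rw [Asymptotics.isLittleO_iff]
  intro c hc
  have : ∀ᶠ k : E in 𝓝 0, ‖k‖ < c := by
    have := Metric.ball_mem_nhds (0:E) hc
    filter_upwards [this] with k hk
    simpa using hk
  filter_upwards [this] with k hk
  have h1 := h.env_ge x (x + k)
  have h2 := h.env_le (x + k) (J x)
  rw [add_sub_cancel_left] at h1
  have e : x + k - J x = (x - J x) + k := by abel
  rw [e, norm_add_sq_real] at h2
  rw [innerSL_apply_apply, Real.norm_eq_abs, abs_le]
  unfold envl at *
  constructor
  · have := mul_nonneg hc.le (norm_nonneg k); linarith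
  · nlinarith [norm_nonneg k]

/-- second-order expansion of the envelope where `J` is differentiable -/
lemma IsProx.env_taylor {f : E → ℝ} {J : E → E} (h : IsProx f J) {x : E} {D : E →L[ℝ] E}
    (hD : HasFDerivAt J D x) {ε : ℝ} (hε : 0 < ε) :
    ∀ᶠ k : E in 𝓝 0, |envl f J (x + k) - envl f J x - inner ℝ (x - J x) k
      - 1/2 * inner ℝ (k - D k) k| ≤ ε * ‖k‖^2 := by
  rw [hasFDerivAt_iff_isLittleO_nhds_zero, Asymptotics.isLittleO_iff] at hD
  have hh := hD hε
  obtain ⟨δ, hδ, hb⟩ := Metric.eventually_nhds_iff_ball.mp hh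
  filter_upwards [Metric.ball_mem_nhds (0:E) hδ] with k hk
  set g : ℝ → ℝ := fun t => envl f J (x + t • k) - t * inner ℝ (x - J x) k
      - 1/2 * t^2 * inner ℝ (k - D k) k with hg
  have hder : ∀ t : ℝ, HasDerivAt g (inner ℝ (x + t • k - J (x + t • k)) k - inner ℝ (x - J x) k
      - t * inner ℝ (k - D k) k) t := by
    intro t
    have h1 := h.env_hasFDerivAt (x + t • k)
    have h2 : HasDerivAt (fun t : ℝ => x + t • k) k t := by
      simpa using ((hasDerivAt_id t).smul_const k).const_add x
    have h3 := h1.comp_hasDerivAt t h2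
    rw [innerSL_apply_apply] at h3
    have h4 := (hasDerivAt_id t).mul_const (inner ℝ (x - J x) k)
    have h5 := (((hasDerivAt_id t).pow 2).const_mul (1/2 : ℝ)).mul_const (inner ℝ (k - D k) k)
    have h6 := (h3.sub h4).sub h5
    refine HasDerivAt.congr_deriv h6 ?_
    simp
  have hmain := norm_image_sub_le_of_norm_deriv_le_segment_01' (f := g) (C := ε * ‖k‖^2)
    (fun t _ => (hder t).hasDerivWithinAt) (by
      intro t ht
      have h1 : t • k ∈ ball (0:E) δ := by
        simp only [mem_ball_zero_iff, norm_smul, Real.norm_eq_abs, abs_of_nonneg ht.1] at hk ⊢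
        nlinarith [norm_nonneg k, ht.2]
      have h2 := hb _ h1
      have e : inner ℝ (x + t • k - J (x + t • k)) k - inner ℝ (x - J x) k
          - t * inner ℝ (k - D k) k = - inner ℝ (J (x + t • k) - J x - D (t • k)) k := by
        rw [map_smul]
        simp only [inner_sub_left, inner_add_left, real_inner_smul_left]
        ring
      rw [e, norm_neg]
      refine (norm_inner_le_norm _ _).trans ?_
      rw [norm_smul, Real.norm_eq_abs, abs_of_nonneg ht.1] at h2
      have h3 := mul_le_mul_of_nonneg_right h2 (norm_nonneg k)
      refine h3.trans ?_
      have : t * (ε * ‖k‖^2) ≤ 1 * (ε * ‖k‖^2) :=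
        mul_le_mul_of_nonneg_right ht.2.le (by positivity)
      nlinarith)
  have e1 : g 1 - g 0 = envl f J (x + k) - envl f J x - inner ℝ (x - J x) k
      - 1/2 * inner ℝ (k - D k) k := by
    simp [hg]; ring
  rw [e1, Real.norm_eq_abs] at hmain
  exact hmain

end JA

section JA2
open Filter
variable {E : Type*} [NormedAddCommGroup E] [InnerProductSpace ℝ E] [FiniteDimensional ℝ E]

lemma contact_star {f : E → ℝ} {J : E → E} (hJ : IsProx f J) {x : E} {D Q : E →L[ℝ] E}
    (hD : HasFDerivAt J D x)
    (hc : ∀ᶠ h in 𝓝 (0:E), f (J x + h) ≤ f (J x) + inner ℝ (x - J x) h + 1/2 * inner ℝ (Q h) h)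
    (h k : E) : inner ℝ (k - D k) k ≤ inner ℝ (Q h) h + ‖k - h‖^2 := by
  apply le_of_forall_pos_le_add
  intro ε hε
  have hε' : 0 < ε / (2 * (‖k‖^2 + 1)) := by positivity
  have h1 := hJ.env_taylor hD hε'
  have tk : ∀ v : E, Tendsto (fun t : ℝ => t • v) (𝓝[>] 0) (𝓝 0) := by
    intro v
    apply Tendsto.mono_left _ nhdsWithin_le_nhds
    have : Continuous (fun t : ℝ => t • v) := by fun_prop
    simpa using this.tendsto 0
  obtain ⟨t, ⟨ht1, ht2⟩, ht0⟩ := (((tk k).eventually h1).and ((tk h).eventually hc)).and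
    self_mem_nhdsWithin |>.exists
  have ht0 : 0 < t := ht0
  have h3 := hJ.env_le (x + t • k) (J x + t • h)
  have e : x + t • k - (J x + t • h) = (x - J x) + t • (k - h) := by module
  rw [e, norm_add_sq_real, norm_smul, inner_smul_right, mul_pow, Real.norm_eq_abs, sq_abs,
    inner_sub_right] at h3
  have h4 := (abs_le.mp ht1).1
  have e2 : envl f J x = f (J x) + 1/2 * ‖x - J x‖^2 := rfl
  have e3 : inner ℝ (t • k - D (t • k)) (t • k) = t^2 * inner ℝ (k - D k) k := by
    rw [map_smul, ← smul_sub, real_inner_smul_left, real_inner_smul_right]; ring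
  have e4 : inner ℝ (Q (t • h)) (t • h) = t^2 * inner ℝ (Q h) h := by
    rw [map_smul, real_inner_smul_left, real_inner_smul_right]; ring
  rw [e3, real_inner_smul_right, norm_smul, mul_pow, Real.norm_eq_abs, sq_abs, e2] at h4
  rw [e4, real_inner_smul_right] at ht2
  have h5 : ε / (2 * (‖k‖^2 + 1)) * ‖k‖^2 ≤ ε / 2 := by
    rw [div_mul_eq_mul_div, div_le_div_iff₀ (by positivity) (by norm_num)]
    nlinarith [sq_nonneg ‖k‖]
  have h6 : t^2 * (ε / (2 * (‖k‖^2 + 1)) * ‖k‖^2) ≤ t^2 * (ε/2) :=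
    mul_le_mul_of_nonneg_left h5 (sq_nonneg t)
  have h7 : t^2 * inner ℝ (k - D k) k ≤ t^2 * (inner ℝ (Q h) h + ‖k - h‖^2 + ε) := by
    nlinarith
  exact le_of_mul_le_mul_left h7 (by positivity)

lemma contact_inv {D Q : E →L[ℝ] E}
    (hs : ∀ h k : E, inner ℝ (k - D k) k ≤ inner ℝ (Q h) h + ‖k - h‖^2) :
    ∃ Di : E →L[ℝ] E, (∀ v, D (Di v) = v) ∧ (∀ v, Di (D v) = v) := by
  have hinj : Function.Injective (D : E →ₗ[ℝ] E) := by
    rw [injective_iff_map_eq_zero]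
    intro k hk
    have hk' : D k = 0 := hk
    by_contra hne
    have hpos : 0 < ‖k‖ := norm_pos_iff.mpr hne
    have hp2 : 0 < ‖k‖^2 := by positivity
    set c := inner ℝ (Q k) k
    have key : ∀ s : ℝ, ‖k‖^2 ≤ s^2 * c + (1-s)^2 * ‖k‖^2 := by
      intro s
      have := hs (s • k) k
      have e : k - s • k = (1 - s) • k := by module
      rw [hk', sub_zero, real_inner_self_eq_norm_sq, map_smul, real_inner_smul_left,
        real_inner_smul_right, e, norm_smul, mul_pow, Real.norm_eq_abs, sq_abs] at this
      nlinarith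
    have hd : 0 < |c| + ‖k‖^2 := by positivity
    have := key (‖k‖^2 / (|c| + ‖k‖^2))
    set s := ‖k‖^2 / (|c| + ‖k‖^2) with hsdef
    have hspos : 0 < s := by positivity
    have hs2 : s * (|c| + ‖k‖^2) = ‖k‖^2 := by rw [hsdef]; field_simp
    have : 0 ≤ s * (s * (c + ‖k‖^2) - 2 * ‖k‖^2) := by nlinarith
    have h8 : 0 ≤ s * (c + ‖k‖^2) - 2 * ‖k‖^2 := by
      by_contra hh; push Not at hh; nlinarith [mul_neg_of_pos_of_neg hspos hh]
    have h9 : s * (c + ‖k‖^2) ≤ s * (|c| + ‖k‖^2) :=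
      mul_le_mul_of_nonneg_left (by linarith [le_abs_self c]) hspos.le
    linarith
  let e := (LinearEquiv.ofInjectiveEndo (D : E →ₗ[ℝ] E) hinj).toContinuousLinearEquiv
  refine ⟨e.symm, fun v => ?_, fun v => ?_⟩
  · exact e.apply_symm_apply v
  · exact e.symm_apply_apply v

lemma contact_expand {f : E → ℝ} {J : E → E} (hf : HasSubg f) (hJ : IsProx f J) {x : E}
    {D Q : E →L[ℝ] E}
    (hD : HasFDerivAt J D x)
    (hc : ∀ᶠ h in 𝓝 (0:E), f (J x + h) ≤ f (J x) + inner ℝ (x - J x) h + 1/2 * inner ℝ (Q h) h) :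
    ∃ A : E →L[ℝ] E, (∀ h, inner ℝ (A h) h ≤ inner ℝ (Q h) h) ∧
      ∀ ε > 0, ∀ᶠ h in 𝓝 (0:E),
        |f (J x + h) - f (J x) - inner ℝ (x - J x) h - 1/2 * inner ℝ (A h) h| ≤ ε * ‖h‖^2 := by
  have hs := contact_star hJ hD hc
  obtain ⟨Di, hDi, hDi'⟩ := contact_inv hs
  have hA : ∀ h, inner ℝ ((Di - ContinuousLinearMap.id ℝ E) h) h = inner ℝ (Di h) h - ‖h‖^2 := by
    intro h
    simp [inner_sub_left]
  refine ⟨Di - ContinuousLinearMap.id ℝ E, ?_, ?_⟩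
  · intro h
    have := hs h (Di h)
    rw [hDi, norm_sub_sq_real, inner_sub_left, real_inner_self_eq_norm_sq,
      real_inner_comm (Di h) h] at this
    rw [hA]
    linarith
  obtain ⟨z, hz⟩ : ∃ z, J x = z := ⟨_, rfl⟩
  obtain ⟨ζ, hζ⟩ : ∃ ζ, x - z = ζ := ⟨_, rfl⟩
  have hxz : x = z + ζ := by rw [← hζ]; abel
  have hev : envl f J x = f z + 1/2 * ‖ζ‖^2 := by unfold envl; rw [hz, hζ]
  rw [hz, hζ] at hc ⊢
  intro ε hε
  -- lower bound
  have hlow : ∀ᶠ h in 𝓝 (0:E), -(ε * ‖h‖^2) ≤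
      f (z + h) - f z - inner ℝ ζ h - 1/2 * (inner ℝ (Di h) h - ‖h‖^2) := by
    have hε' : 0 < ε / (‖Di‖^2 + 1) := by positivity
    have h1 := hJ.env_taylor hD hε'
    rw [hz, hζ] at h1
    have ht : Tendsto (fun h => Di h) (𝓝 0) (𝓝 0) := by
      simpa using Di.continuous.tendsto 0
    filter_upwards [ht.eventually h1] with h hh
    have h2 := hJ.env_le (x + Di h) (z + h)
    have e : x + Di h - (z + h) = ζ + (Di h - h) := by rw [← hζ]; abel
    have h3 := (abs_le.mp hh).1
    rw [e, norm_add_sq_real, inner_sub_right, norm_sub_sq_real] at h2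
    rw [hDi, inner_sub_left (Di h), real_inner_self_eq_norm_sq, real_inner_comm (Di h) h, hev] at h3
    have h4 : ε / (‖Di‖^2 + 1) * ‖Di h‖^2 ≤ ε * ‖h‖^2 := by
      have h5 := Di.le_opNorm h
      have h6 : ‖Di h‖^2 ≤ (‖Di‖^2 + 1) * ‖h‖^2 := by
        have := pow_le_pow_left₀ (norm_nonneg _) h5 2
        nlinarith [sq_nonneg ‖h‖]
      rw [div_mul_eq_mul_div, div_le_iff₀ (by positivity)]
      nlinarith
    linarith
  have hup : ∀ᶠ h in 𝓝 (0:E), 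
      f (z + h) - f z - inner ℝ ζ h - 1/2 * (inner ℝ (Di h) h - ‖h‖^2) ≤ ε * ‖h‖^2 := by
    set C := ‖Q‖
    have hC : 0 ≤ C := norm_nonneg _
    set M := 1 + 2 * C with hM
    have hMpos : 0 < M := by positivity
    have hε1 : 0 < ε / (2 * M^2) := by positivity
    have hε2 : 0 < ε / (M^2 + ‖Di‖ * M) := by positivity
    have h1 := hJ.env_taylor hD hε1
    rw [hz, hζ] at h1
    have h1' := hD
    rw [hasFDerivAt_iff_isLittleO_nhds_zero, Asymptotics.isLittleO_iff] at h1'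
    obtain ⟨δ, hδ, hb⟩ := Metric.eventually_nhds_iff_ball.mp (h1.and (h1' hε2))
    obtain ⟨δ', hδ', hb'⟩ := Metric.eventually_nhds_iff_ball.mp hc
    have hδ3 : 0 < min (δ / M) (δ' / 2) := by positivity
    filter_upwards [Metric.ball_mem_nhds (0:E) hδ3] with h hh
    rw [mem_ball_zero_iff, lt_min_iff, lt_div_iff₀ hMpos] at hh
    by_cases h0 : h = 0
    · simp [h0]
    have hhpos : 0 < ‖h‖ := norm_pos_iff.mpr h0
    obtain ⟨ζ', hζ'⟩ := hf (z + h)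
    have hd : ‖ζ' - ζ‖ ≤ 2 * C * ‖h‖ := by
      by_cases hd0 : ζ' - ζ = 0
      · rw [hd0, norm_zero]; positivity
      have hdpos : 0 < ‖ζ' - ζ‖ := norm_pos_iff.mpr hd0
      set d := ζ' - ζ with hd
      set v := (‖h‖ / ‖d‖) • d with hv
      have hvn : ‖v‖ = ‖h‖ := by
        rw [hv, norm_smul, Real.norm_eq_abs, abs_of_pos (by positivity)]; field_simp
      have hhv : ‖h + v‖ ≤ 2 * ‖h‖ := (norm_add_le _ _).trans (by linarith)
      have a1 := hb' (h + v) (by rw [mem_ball_zero_iff]; linarith)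
      have a2 := hζ' (z + (h + v))
      have a3 := hJ x (z + h)
      rw [hz, hζ, add_sub_cancel_left] at a3
      have e1 : z + (h + v) - (z + h) = v := by abel
      rw [e1] at a2
      rw [inner_add_right ζ] at a1
      have a4 : inner ℝ (Q (h + v)) (h + v) ≤ C * (2 * ‖h‖)^2 := by
        calc inner ℝ (Q (h + v)) (h + v) ≤ ‖Q (h + v)‖ * ‖h + v‖ := real_inner_le_norm _ _
          _ ≤ (C * ‖h + v‖) * ‖h + v‖ := by gcongr; exact Q.le_opNorm _
          _ = C * ‖h + v‖^2 := by ring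
          _ ≤ C * (2 * ‖h‖)^2 := by gcongr
      have a5 : inner ℝ d v = ‖h‖ * ‖d‖ := by
        rw [hv, real_inner_smul_right, real_inner_self_eq_norm_sq]; field_simp
      have a6 : inner ℝ d v = inner ℝ ζ' v - inner ℝ ζ v := by rw [hd, inner_sub_left]
      have a7 : ‖h‖ * ‖d‖ ≤ ‖h‖ * (2 * C * ‖h‖) := by nlinarith
      exact le_of_mul_le_mul_left a7 hhpos
    set k := h + (ζ' - ζ) with hk
    have hkn : ‖k‖ ≤ M * ‖h‖ := (norm_add_le _ _).trans (by rw [hM]; linarith)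
    have hJk : J (x + k) = z + h := by
      have : x + k = (z + h) + ζ' := by rw [hk, hxz]; abel
      rw [this]; exact hJ.eq_of_subg hζ'
    obtain ⟨b1, b2⟩ := hb k (by rw [mem_ball_zero_iff]; linarith)
    rw [hJk, hz, add_sub_cancel_left] at b2
    set r := h - D k with hr
    have b3 := (abs_le.mp b1).2
    have e1 : envl f J (x + k) = f (z + h) + 1/2 * ‖ζ + (k - h)‖^2 := by
      unfold envl; rw [hJk]
      have : x + k - (z + h) = ζ + (k - h) := by rw [← hζ]; abel
      rw [this]
    have hDk : D k = h - r := by rw [hr]; abel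
    have hkr : k = Di h - Di r := by
      rw [← map_sub, ← hDk, hDi']
    rw [e1, hev, norm_add_sq_real, inner_sub_right ζ, norm_sub_sq_real, hDk, inner_sub_left k,
      inner_sub_left h, real_inner_self_eq_norm_sq, real_inner_comm k h] at b3
    have e2 : inner ℝ k h = inner ℝ (Di h) h - inner ℝ (Di r) h := by
      rw [hkr, inner_sub_left]
    have c1 : |inner ℝ r k| ≤ ‖r‖ * ‖k‖ := abs_real_inner_le_norm _ _
    have c2 : |inner ℝ (Di r) h| ≤ ‖Di‖ * ‖r‖ * ‖h‖ :=
      (abs_real_inner_le_norm _ _).trans (by gcongr; exact Di.le_opNorm r)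
    have hrn : ‖r‖ ≤ ε / (M^2 + ‖Di‖ * M) * (M * ‖h‖) := b2.trans (by gcongr)
    have c3 : ‖r‖ * ‖k‖ + ‖Di‖ * ‖r‖ * ‖h‖ ≤ ε * ‖h‖^2 := by
      calc ‖r‖ * ‖k‖ + ‖Di‖ * ‖r‖ * ‖h‖ ≤ ‖r‖ * (M * ‖h‖) + ‖Di‖ * ‖r‖ * ‖h‖ := by gcongr
        _ = ‖r‖ * ((M + ‖Di‖) * ‖h‖) := by ring
        _ ≤ (ε / (M^2 + ‖Di‖ * M) * (M * ‖h‖)) * ((M + ‖Di‖) * ‖h‖) := by gcongr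
        _ = ε * ‖h‖^2 := by field_simp
    have c4 : ε / (2 * M^2) * ‖k‖^2 ≤ ε / 2 * ‖h‖^2 := by
      calc ε / (2 * M^2) * ‖k‖^2 ≤ ε / (2 * M^2) * (M * ‖h‖)^2 := by gcongr
        _ = ε / 2 * ‖h‖^2 := by field_simp
    have d1 := (abs_le.mp c1)
    have d2 := (abs_le.mp c2)
    linarith [d1.1, d1.2, d2.1, d2.2]
  filter_upwards [hlow, hup] with h a1 a2
  rw [hA, abs_le]
  exact ⟨a1, a2⟩

end JA2

section JA3
open Filter
variable {E : Type*} [NormedAddCommGroup E] [InnerProductSpace ℝ E] [FiniteDimensional ℝ E]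

/-- choose a parameter outside the Lipschitz image of the non-differentiability set -/
lemma exists_good_param {J P : E → E} {C : NNReal} (hJ : LipschitzWith 1 J)
    (hP : LipschitzWith C P) {δ : ℝ} (hδ : 0 < δ) :
    ∃ p : E, ‖p‖ < δ ∧ ∀ x, P x = p → DifferentiableAt ℝ J x := by
  borelize E
  set μ : Measure E := Measure.hausdorffMeasure (Module.finrank ℝ E : ℝ) with hμ
  have hae : ∀ᵐ x ∂μ, DifferentiableAt ℝ J x := hJ.ae_differentiableAt
  have hN : μ {x | ¬ DifferentiableAt ℝ J x} = 0 := hae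
  have hPN : μ (P '' {x | ¬ DifferentiableAt ℝ J x}) = 0 := by
    have := hP.hausdorffMeasure_image_le (d := (Module.finrank ℝ E : ℝ)) (by positivity)
      {x | ¬ DifferentiableAt ℝ J x}
    rw [← hμ, hN, mul_zero] at this
    exact le_antisymm this (zero_le)
  have hb : 0 < μ (ball (0:E) δ) := measure_ball_pos μ 0 hδ
  by_contra hcon
  push Not at hcon
  have : ball (0:E) δ ⊆ P '' {x | ¬ DifferentiableAt ℝ J x} := by
    intro p hp
    obtain ⟨x, hx, hx'⟩ := hcon p (by simpa using hp)
    exact ⟨x, hx', hx⟩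
  have h2 := measure_mono (μ := μ) this
  rw [hPN] at h2
  exact absurd hb (not_lt.mpr h2)

/-- Jensen--Alexandrov lemma -/
theorem jensen_alexandrov {f : E → ℝ} (hf : HasSubg f) (z₀ b : E) (Q : E →L[ℝ] E)
    (hQ : ∀ x y, inner ℝ (Q x) y = inner ℝ x (Q y))
    (hloc : ∀ᶠ h in 𝓝 (0:E), f (z₀ + h) ≤ f z₀ + inner ℝ b h + 1/2 * inner ℝ (Q h) h)
    {η : ℝ} (hη : 0 < η) :
    ∃ (z ζ : E) (A : E →L[ℝ] E), ‖z - z₀‖ < η ∧ ‖ζ - b‖ < η ∧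
      (∀ h, inner ℝ (A h) h ≤ inner ℝ (Q h) h + η * ‖h‖^2) ∧
      ∀ ε > 0, ∀ᶠ h in 𝓝 (0:E),
        |f (z + h) - f z - inner ℝ ζ h - 1/2 * inner ℝ (A h) h| ≤ ε * ‖h‖^2 := by
  obtain ⟨J, hJ'⟩ := hf.exists_prox
  have hJ : IsProx f J := hJ'
  have hfc := hf.continuous
  set R : E →L[ℝ] E := Q + η • ContinuousLinearMap.id ℝ E with hR
  have hRapp : ∀ h, R h = Q h + η • h := fun h => by simp [hR]
  have hRsym : ∀ x y, inner ℝ (R x) y = inner ℝ x (R y) := by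
    intro x y
    rw [hRapp, hRapp, inner_add_left, inner_add_right, hQ, real_inner_smul_left,
      real_inner_smul_right]
  have hRR : ∀ h, inner ℝ (R h) h = inner ℝ (Q h) h + η * ‖h‖^2 := by
    intro h
    rw [hRapp, inner_add_left, real_inner_smul_left, real_inner_self_eq_norm_sq]
  set P : E → E := fun x => x - J x - b - R (J x - z₀) with hP
  have hPlip : ∃ C : NNReal, LipschitzWith C P := by
    have h1 := ((LipschitzWith.id (α := E)).sub hJ.lipschitz).sub (LipschitzWith.const b)
    have h2 := R.lipschitz.comp (hJ.lipschitz.sub (LipschitzWith.const z₀))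
    exact ⟨_, h1.sub h2⟩
  obtain ⟨C, hPC⟩ := hPlip
  obtain ⟨s, hs, hsb⟩ := Metric.eventually_nhds_iff_ball.mp hloc
  set s' := min (s/2) (η/2) with hs'
  have hs'pos : 0 < s' := by positivity
  set δ := min (η * s' / 4) (η / (4 * (1 + ‖R‖) * (1 + 2/η))) with hδ
  have hδpos : 0 < δ := by positivity
  obtain ⟨p, hp, hpJ⟩ := exists_good_param hJ.lipschitz hPC hδpos
  -- the maximum point
  set G : E → ℝ := fun y => f y - inner ℝ (b + p) (y - z₀) - 1/2 * inner ℝ (R (y - z₀)) (y - z₀)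
    with hG
  have hGc : Continuous G := by fun_prop
  obtain ⟨z, hzmem, hzmax⟩ := (isCompact_closedBall z₀ s').exists_isMaxOn
    ⟨z₀, mem_closedBall_self hs'pos.le⟩ hGc.continuousOn
  have hG0 : G z₀ = f z₀ := by simp [hG]
  have hzn : ‖z - z₀‖ ≤ s' := by simpa [dist_eq_norm] using hzmem
  have hzle : ‖z - z₀‖ ≤ 2 * ‖p‖ / η := by
    have h1 : G z₀ ≤ G z := hzmax (mem_closedBall_self hs'pos.le)
    have h2 := hsb (z - z₀) (by
      rw [mem_ball_zero_iff]; have := min_le_left (s/2) (η/2); linarith)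
    rw [add_sub_cancel] at h2
    rw [hG0] at h1
    simp only [hG] at h1
    rw [hRR, inner_add_left] at h1
    have h3 := abs_real_inner_le_norm p (z - z₀)
    have h4 := (abs_le.mp h3).1
    have h5 : η * ‖z - z₀‖^2 ≤ 2 * ‖p‖ * ‖z - z₀‖ := by nlinarith
    rw [le_div_iff₀ hη]
    by_cases h0 : ‖z - z₀‖ = 0
    · rw [h0]; simp
    have : 0 < ‖z - z₀‖ := lt_of_le_of_ne (norm_nonneg _) (Ne.symm h0)
    have h6 : ‖z - z₀‖ * (‖z - z₀‖ * η) ≤ ‖z - z₀‖ * (2 * ‖p‖) := by nlinarith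
    exact le_of_mul_le_mul_left h6 this
  have hzlt : ‖z - z₀‖ < s' := by
    have h1 : ‖p‖ < η * s' / 4 := lt_of_lt_of_le hp (min_le_left _ _)
    have h2 : 2 * ‖p‖ / η < s' := by rw [div_lt_iff₀ hη]; nlinarith
    linarith
  set ζ := b + p + R (z - z₀) with hζ
  have hcontact : ∀ᶠ h in 𝓝 (0:E), f (z + h) ≤ f z + inner ℝ ζ h + 1/2 * inner ℝ (R h) h := by
    have hpos : 0 < s' - ‖z - z₀‖ := by linarith
    filter_upwards [Metric.ball_mem_nhds (0:E) hpos] with h hh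
    rw [mem_ball_zero_iff] at hh
    have e : z + h - z₀ = (z - z₀) + h := by abel
    have hmem : z + h ∈ closedBall z₀ s' := by
      rw [mem_closedBall, dist_eq_norm, e]
      exact (norm_add_le _ _).trans (by linarith)
    have h1 : G (z + h) ≤ G z := hzmax hmem
    simp only [hG] at h1
    rw [e] at h1
    generalize z - z₀ = d at *
    rw [hζ, inner_add_left (b + p)]
    rw [inner_add_right (b + p), map_add, inner_add_left (R d), inner_add_right (R d),
      inner_add_right (R h), hRsym h d, real_inner_comm (R d) h] at h1
    linarith
  have hsubg : ∀ y, f z + inner ℝ ζ (y - z) ≤ f y := by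
    obtain ⟨ζ', hζ'⟩ := hf z
    suffices ζ' = ζ by rw [← this]; exact hζ'
    by_contra hne
    have hd0 : ζ' - ζ ≠ 0 := sub_ne_zero.mpr hne
    set d := ζ' - ζ with hd
    have hdp : 0 < ‖d‖ := norm_pos_iff.mpr hd0
    have tk : Tendsto (fun t : ℝ => t • d) (𝓝[>] 0) (𝓝 0) := by
      apply Tendsto.mono_left _ nhdsWithin_le_nhds
      have : Continuous (fun t : ℝ => t • d) := by fun_prop
      simpa using this.tendsto 0
    have hsm : Ioo (0:ℝ) (1 / (‖R‖ + 1)) ∈ 𝓝[>] (0:ℝ) := Ioo_mem_nhdsGT (by positivity)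
    obtain ⟨t, ht1, ht2⟩ := ((tk.eventually hcontact).and hsm).exists
    have ht0 := ht2.1
    have h1 := hζ' (z + t • d)
    rw [add_sub_cancel_left] at h1
    have h2 : inner ℝ (R (t • d)) (t • d) ≤ ‖R‖ * (t * ‖d‖)^2 := by
      refine (real_inner_le_norm _ _).trans ?_
      have := R.le_opNorm (t • d)
      have e : ‖t • d‖ = t * ‖d‖ := by rw [norm_smul, Real.norm_eq_abs, abs_of_pos ht0]
      rw [e] at this ⊢
      calc _ ≤ ‖R‖ * (t * ‖d‖) * (t * ‖d‖) := by gcongr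
        _ = _ := by ring
    have h3 : inner ℝ d (t • d) = t * ‖d‖^2 := by
      rw [real_inner_smul_right, real_inner_self_eq_norm_sq]
    have h4 : inner ℝ d (t • d) = inner ℝ ζ' (t • d) - inner ℝ ζ (t • d) := by
      rw [hd, inner_sub_left]
    have h5 : t * ‖d‖^2 ≤ 1/2 * (‖R‖ * (t * ‖d‖)^2) := by linarith
    have h6 : t * (‖R‖ + 1) < 1 := by
      have := ht2.2; rwa [lt_div_iff₀ (by positivity)] at this
    have h7 : 0 < t * ‖d‖^2 := by positivity
    have h8 : t * ‖R‖ < 1 := by nlinarith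
    have h9 : ‖R‖ * (t * ‖d‖)^2 = (t * ‖R‖) * (t * ‖d‖^2) := by ring
    nlinarith
  have hJz : J (z + ζ) = z := hJ.eq_of_subg hsubg
  have hPz : P (z + ζ) = p := by
    simp only [hP]; rw [hJz, hζ]; abel
  have hdiff := hpJ _ hPz
  obtain ⟨A, hA1, hA2⟩ := contact_expand hf hJ (x := z + ζ) (Q := R) hdiff.hasFDerivAt (by
    rw [hJz, add_sub_cancel_left]; exact hcontact)
  rw [hJz, add_sub_cancel_left] at hA2
  refine ⟨z, ζ, A, ?_, ?_, ?_, hA2⟩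
  · have := min_le_right (s/2) (η/2); linarith
  · have e : ζ - b = p + R (z - z₀) := by rw [hζ]; abel
    rw [e]
    have h1 : ‖R (z - z₀)‖ ≤ ‖R‖ * (2 * ‖p‖ / η) := (R.le_opNorm _).trans (by gcongr)
    have h2 : ‖p + R (z - z₀)‖ ≤ ‖p‖ + ‖R‖ * (2 * ‖p‖ / η) := (norm_add_le _ _).trans (by linarith)
    have h3 : ‖p‖ + ‖R‖ * (2 * ‖p‖ / η) ≤ ‖p‖ * ((1 + ‖R‖) * (1 + 2/η)) := by
      have : ‖p‖ * ((1 + ‖R‖) * (1 + 2/η)) = ‖p‖ + ‖R‖ * (2 * ‖p‖ / η) + ‖p‖ * ‖R‖ + ‖p‖ * (2 / η) := by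
        field_simp; ring
      have a1 : 0 ≤ ‖p‖ * ‖R‖ := by positivity
      have a2 : 0 ≤ ‖p‖ * (2/η) := by positivity
      linarith
    have h4 : ‖p‖ < η / (4 * (1 + ‖R‖) * (1 + 2/η)) := lt_of_lt_of_le hp (min_le_right _ _)
    rw [lt_div_iff₀ (by positivity)] at h4
    nlinarith
  · intro h; rw [← hRR]; exact hA1 h

end JA3

section VM
open Filter
variable {n : ℕ}

def bilOf (T : En n →L[ℝ] En n) : En n →L[ℝ] En n →L[ℝ] ℝ :=
  LinearMap.toContinuousBilinearMap
    (LinearMap.mk₂ ℝ (fun v w => 1/2 * (inner ℝ (T v) w + inner ℝ (T w) v))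
      (by intro a b c; simp only [map_add, inner_add_left, inner_add_right]; ring)
      (by intro a b c; simp only [map_smul, inner_smul_left, inner_smul_right, smul_eq_mul, conj_trivial]; ring)
      (by intro a b c; simp only [map_add, inner_add_left, inner_add_right]; ring)
      (by intro a b c; simp only [map_smul, inner_smul_left, inner_smul_right, smul_eq_mul, conj_trivial]; ring))

lemma bilOf_apply (T : En n →L[ℝ] En n) (v w : En n) :
    bilOf T v w = 1/2 * (inner ℝ (T v) w + inner ℝ (T w) v) := rfl

def matOf (T : En n →L[ℝ] En n) : Mat n :=
  Matrix.of fun i j => bilOf T (EuclideanSpace.single i (1 : ℝ)) (EuclideanSpace.single j (1 : ℝ))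

def quadF (x p : En n) (T : En n →L[ℝ] En n) (y : En n) : ℝ :=
  inner ℝ p (y - x) + 1/2 * inner ℝ (T (y - x)) (y - x)

lemma quadF_contDiff (x p : En n) (T : En n →L[ℝ] En n) : ContDiff ℝ 2 (quadF x p T) := by
  unfold quadF
  have : ContDiff ℝ 2 (fun y : En n => y - x) := by fun_prop
  exact (contDiff_const.inner ℝ this).add
    (contDiff_const.mul ((T.contDiff.comp this).inner ℝ this))

lemma quadF_hasFDerivAt (x p : En n) (T : En n →L[ℝ] En n) (y : En n) :
    HasFDerivAt (quadF x p T) (innerSL ℝ p + bilOf T (y - x)) y := by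
  have h1 : HasFDerivAt (fun y : En n => y - x) (ContinuousLinearMap.id ℝ (En n)) y :=
    (hasFDerivAt_id y).sub_const x
  have h2 : HasFDerivAt (fun y : En n => T (y - x)) T y := by
    have := T.hasFDerivAt.comp y h1
    rw [ContinuousLinearMap.comp_id] at this
    exact this
  have h3 := (hasFDerivAt_const p y).inner ℝ h1
  have h4 := (h2.inner ℝ h1).const_mul (1/2 : ℝ)
  refine (h3.add h4).congr_fderiv ?_
  ext v
  simp [bilOf_apply, fderivInnerCLM_apply, inner_sub_left, inner_sub_right]
  ring

lemma quadF_fderiv (x p : En n) (T : En n →L[ℝ] En n) :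
    fderiv ℝ (quadF x p T) = fun y => innerSL ℝ p + bilOf T (y - x) :=
  funext fun y => (quadF_hasFDerivAt x p T y).fderiv

lemma quadF_gradient (x p : En n) (T : En n →L[ℝ] En n) : gradient (quadF x p T) x = p := by
  apply HasGradientAt.gradient
  rw [hasGradientAt_iff_hasFDerivAt]
  refine (quadF_hasFDerivAt x p T x).congr_fderiv ?_
  ext v
  simp

lemma quadF_hessian (x p : En n) (T : En n →L[ℝ] En n) :
    hessianMatrix (quadF x p T) x = matOf T := by
  ext i j
  simp only [hessianMatrix, matOf, Matrix.of_apply]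
  rw [iteratedFDeriv_two_apply, quadF_fderiv]
  have h1 : HasFDerivAt (fun y : En n => y - x) (ContinuousLinearMap.id ℝ (En n)) x :=
    (hasFDerivAt_id x).sub_const x
  have h2 : HasFDerivAt (fun y : En n => innerSL ℝ p + bilOf T (y - x)) (bilOf T) x := by
    have := ((bilOf T).hasFDerivAt.comp x h1).const_add (innerSL ℝ p)
    simpa using this
  rw [h2.fderiv]
  simp

lemma matOf_symm (T : En n →L[ℝ] En n) : (matOf T).IsSymm := by
  ext i j
  simp only [matOf, Matrix.transpose_apply, Matrix.of_apply, bilOf_apply]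
  ring

lemma matOf_dot (T : En n →L[ℝ] En n) (v : En n) :
    (v : Fin n → ℝ) ⬝ᵥ (Matrix.mulVec (matOf T) v) = inner ℝ (T v) v := by
  have hv : v = ∑ i, v i • EuclideanSpace.single i (1:ℝ) := by
    ext j
    simp [Finset.sum_apply, Pi.single_apply]
  have h : bilOf T v v = inner ℝ (T v) v := by rw [bilOf_apply]; ring
  rw [← h]
  conv_rhs => rw [hv]
  simp only [map_sum, map_smul, _root_.sum_apply, _root_.smul_apply,
    smul_eq_mul, dotProduct, Matrix.mulVec, matOf, Matrix.of_apply, Finset.mul_sum]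
  rw [Finset.sum_comm]
  refine Finset.sum_congr rfl fun i _ => Finset.sum_congr rfl fun j _ => ?_
  ring

open scoped MatrixOrder in
lemma psd_trace_ge {P : Mat n} (hP : P.PosSemidef) (e : En n) (he : ‖e‖ = 1) :
    (e : Fin n → ℝ) ⬝ᵥ (Matrix.mulVec P e) ≤ P.trace := by
  obtain ⟨B, rfl⟩ := CStarAlgebra.nonneg_iff_eq_star_mul_self.mp hP.nonneg
  rw [Matrix.star_eq_conjTranspose]
  have h1 : ∑ j, (e j)^2 = 1 := by
    have := EuclideanSpace.norm_sq_eq e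
    rw [he] at this
    simpa using this.symm
  have h2 : (e : Fin n → ℝ) ⬝ᵥ (Matrix.mulVec (B.conjTranspose * B) e)
      = ∑ i, (∑ j, B i j * e j)^2 := by
    rw [← Matrix.mulVec_mulVec, Matrix.dotProduct_mulVec, Matrix.vecMul_conjTranspose]
    simp [dotProduct, Matrix.mulVec, pow_two]
  have h3 : (B.conjTranspose * B).trace = ∑ i, ∑ j, (B i j)^2 := by
    rw [Matrix.trace_mul_comm]
    simp [Matrix.trace, Matrix.mul_apply, pow_two]
  rw [h2, h3]
  refine Finset.sum_le_sum fun i _ => ?_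
  have := Finset.sum_mul_sq_le_sq_mul_sq Finset.univ (fun j => B i j) (fun j => e j)
  rw [h1, mul_one] at this
  exact this

lemma matOf_add (S T : En n →L[ℝ] En n) : matOf (S + T) = matOf S + matOf T := by
  ext i j
  simp only [matOf, Matrix.of_apply, bilOf_apply, Matrix.add_apply, _root_.add_apply,
    inner_add_left]
  ring

lemma matOf_neg (T : En n →L[ℝ] En n) : matOf (-T) = - matOf T := by
  ext i j
  simp only [matOf, Matrix.of_apply, bilOf_apply, Matrix.neg_apply, _root_.neg_apply,
    inner_neg_left]
  ring

lemma ellip_alg {lam Lam : ℝ} (hlam : 0 < lam) {F : Mat n → ℝ} (hF : UniformlyElliptic lam Lam F)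
    {T1 T2 : En n →L[ℝ] En n} {c m C0 : ℝ} (hc : 0 ≤ c)
    (h1 : F (matOf T1) ≤ C0) (h2 : -C0 ≤ F (matOf (-T2)))
    (hT : ∀ ξ, inner ℝ (T1 ξ) ξ + inner ℝ (T2 ξ) ξ ≤ c * ‖ξ‖^2)
    {e : En n} (he : ‖e‖ = 1) (hm : inner ℝ (T1 e) e + inner ℝ (T2 e) e ≤ -m) :
    lam * m ≤ Lam * n * c + 2 * C0 := by
  let I := ContinuousLinearMap.id ℝ (En n)
  have psd : ∀ T : En n →L[ℝ] En n, (∀ ξ, 0 ≤ inner ℝ (T ξ) ξ) → (matOf T).PosSemidef := by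
    intro T h
    refine Matrix.PosSemidef.of_dotProduct_mulVec_nonneg ?_ ?_
    · have := matOf_symm T
      rw [Matrix.IsHermitian, Matrix.conjTranspose_eq_transpose_of_trivial]; exact this
    · intro x
      have := matOf_dot T (WithLp.toLp 2 x)
      simp only [star_trivial]
      exact (h (WithLp.toLp 2 x)).trans_eq this.symm
  let R := c • I - T1 - T2
  have hR : ∀ ξ, inner ℝ (R ξ) ξ = c * ‖ξ‖^2 - (inner ℝ (T1 ξ) ξ + inner ℝ (T2 ξ) ξ) := by
    intro ξ
    simp only [R, I, _root_.sub_apply, _root_.smul_apply,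
      ContinuousLinearMap.id_apply, inner_sub_left, inner_smul_left, real_inner_self_eq_norm_sq,
      conj_trivial]
    ring
  have pR := psd R (fun ξ => by rw [hR]; linarith [hT ξ])
  have pI := psd (c • I) (fun ξ => by
    simp only [I, _root_.smul_apply,
      ContinuousLinearMap.id_apply, inner_smul_left, real_inner_self_eq_norm_sq, conj_trivial]
    positivity)
  have tR : c + m ≤ (matOf R).trace := by
    have := psd_trace_ge pR e he
    rw [matOf_dot, hR, he] at this
    linarith
  have tI : (matOf (c • I)).trace = n * c := by
    simp [Matrix.trace, matOf, bilOf_apply, I, inner_smul_left, Matrix.diag]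
    left; ring
  have e1 := (hF.2 _ _ (matOf_symm (-T2)) (matOf_symm (c • I)) pI).2
  have e2 := (hF.2 _ _ (matOf_symm T1) (matOf_symm R) pR).1
  rw [← matOf_add] at e1 e2
  have : T1 + R = -T2 + c • I := by simp only [R]; abel
  rw [this] at e2
  rw [tI] at e1
  have := mul_le_mul_of_nonneg_left tR hlam.le
  nlinarith [mul_nonneg hlam.le hc]

lemma ell_ge {μ : ℝ} {z : En n} (hz : 1 ≤ ‖z‖) : 1 ≤ ellReg μ z := by
  unfold ellReg
  rw [Real.one_le_sqrt]
  nlinarith [sq_nonneg μ]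

lemma mp_sub {Ω : Set (En n)} {F : Mat n → ℝ} {μ : ℝ} (hμ : μ ∈ Icc (0:ℝ) 1)
    {p q s a b f u : En n → ℝ} (hp : ∀ x ∈ Ω, 0 ≤ p x) (ha : ∀ x ∈ Ω, 0 ≤ a x)
    (hb : ∀ x ∈ Ω, 0 ≤ b x) (hu : ViscSubOn Ω (mpOp F μ p q s a b f) u) {x g : En n}
    {T : En n →L[ℝ] En n} (hx : x ∈ Ω) (hg : 1 ≤ ‖g‖) {Mu Mf : ℝ} (hMu : |u x| ≤ Mu)
    (hMf : |f x| ≤ Mf)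
    (h : ∀ᶠ h in 𝓝 (0:En n), u (x + h) ≤ u x + inner ℝ g h + 1/2 * inner ℝ (T h) h) :
    F (matOf T) ≤ Mu + Mf := by
  have h1 : IsLocalMaxOn (fun y => u y - quadF x g T y) Ω x := by
    apply IsLocalMax.on
    have ht : Tendsto (fun y => y - x) (𝓝 x) (𝓝 (0 : En n)) := by
      have : Continuous (fun y : En n => y - x) := by fun_prop
      simpa using this.tendsto x
    filter_upwards [ht.eventually h] with y hy
    simp only [add_sub_cancel] at hy
    simp only [quadF, sub_self, map_zero, inner_zero_right]
    linarith
  have h2 := hu _ (quadF_contDiff x g T) x hx h1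
  rw [quadF_gradient, quadF_hessian] at h2
  unfold mpOp at h2
  have hl := ell_ge (μ := μ) hg
  have hG : 1 ≤ ellReg μ g ^ p x + a x * ellReg μ g ^ q x + b x * ellReg μ g ^ s x := by
    have := Real.one_le_rpow hl (hp x hx)
    have := mul_nonneg (ha x hx) (Real.rpow_nonneg (zero_le_one.trans hl) (q x))
    have := mul_nonneg (hb x hx) (Real.rpow_nonneg (zero_le_one.trans hl) (s x))
    linarith
  have hMf' := abs_le.mp hMf
  have hMu' := abs_le.mp hMu
  have hMf0 : 0 ≤ Mf := (abs_nonneg _).trans hMf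
  have hMu0 : 0 ≤ Mu := (abs_nonneg _).trans hMu
  have key : μ * u x + F (matOf T) ≤ Mf := by
    by_contra hcon
    push Not at hcon
    nlinarith
  have : -Mu ≤ μ * u x := by
    have := hμ.1; have := hμ.2
    nlinarith
  linarith

lemma mp_sup {Ω : Set (En n)} {F : Mat n → ℝ} {μ : ℝ} (hμ : μ ∈ Icc (0:ℝ) 1)
    {p q s a b f u : En n → ℝ} (hp : ∀ x ∈ Ω, 0 ≤ p x) (ha : ∀ x ∈ Ω, 0 ≤ a x)
    (hb : ∀ x ∈ Ω, 0 ≤ b x) (hu : ViscSupOn Ω (mpOp F μ p q s a b f) u) {x g : En n}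
    {T : En n →L[ℝ] En n} (hx : x ∈ Ω) (hg : 1 ≤ ‖g‖) {Mu Mf : ℝ} (hMu : |u x| ≤ Mu)
    (hMf : |f x| ≤ Mf)
    (h : ∀ᶠ h in 𝓝 (0:En n), -u (x + h) ≤ -u x + inner ℝ g h + 1/2 * inner ℝ (T h) h) :
    -(Mu + Mf) ≤ F (matOf (-T)) := by
  have h1 : IsLocalMinOn (fun y => u y - quadF x (-g) (-T) y) Ω x := by
    apply IsLocalMin.on
    have ht : Tendsto (fun y => y - x) (𝓝 x) (𝓝 (0 : En n)) := by
      have : Continuous (fun y : En n => y - x) := by fun_prop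
      simpa using this.tendsto x
    filter_upwards [ht.eventually h] with y hy
    simp only [add_sub_cancel] at hy
    simp only [quadF, sub_self, map_zero, inner_zero_right, inner_neg_left,
      _root_.neg_apply]
    linarith
  have h2 := hu _ (quadF_contDiff x (-g) (-T)) x hx h1
  rw [quadF_gradient, quadF_hessian] at h2
  unfold mpOp at h2
  have hl := ell_ge (μ := μ) (z := -g) (by rwa [norm_neg])
  have hG : 1 ≤ ellReg μ (-g) ^ p x + a x * ellReg μ (-g) ^ q x + b x * ellReg μ (-g) ^ s x := by
    have := Real.one_le_rpow hl (hp x hx)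
    have := mul_nonneg (ha x hx) (Real.rpow_nonneg (zero_le_one.trans hl) (q x))
    have := mul_nonneg (hb x hx) (Real.rpow_nonneg (zero_le_one.trans hl) (s x))
    linarith
  have hMf' := abs_le.mp hMf
  have hMu' := abs_le.mp hMu
  have hMf0 : 0 ≤ Mf := (abs_nonneg _).trans hMf
  have hMu0 : 0 ≤ Mu := (abs_nonneg _).trans hMu
  have key : -Mf ≤ μ * u x + F (matOf (-T)) := by
    by_contra hcon
    push Not at hcon
    nlinarith
  have : μ * u x ≤ Mu := by
    have := hμ.1; have := hμ.2
    nlinarith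
  linarith

end VM

section SC
open Filter
variable {E : Type*} [NormedAddCommGroup E] [InnerProductSpace ℝ E] [FiniteDimensional ℝ E]

lemma norm_quad_bound {a : E} (ha : a ≠ 0) {η : ℝ} (hη : 0 < η) :
    ∀ᶠ d in 𝓝 (0:E), ‖a + d‖ ≤ ‖a‖ + inner ℝ a d / ‖a‖
      + (‖d‖^2 - (inner ℝ a d / ‖a‖)^2) / (2 * ‖a‖) + η * ‖d‖^2 := by
  have hr : 0 < ‖a‖ := norm_pos_iff.mpr ha
  set r := ‖a‖ with hrdef
  have h1 : ∀ᶠ d in 𝓝 (0:E), ‖d‖ < r := by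
    have := (continuous_norm (E := E)).tendsto 0
    rw [norm_zero] at this
    exact this.eventually (gt_mem_nhds hr)
  have h2 : ∀ᶠ d in 𝓝 (0:E), ‖d‖ * (1/(2*r) + η) < r * η := by
    have : Continuous (fun d : E => ‖d‖ * (1/(2*r) + η)) := by fun_prop
    have := this.tendsto 0
    rw [norm_zero, zero_mul] at this
    exact this.eventually (gt_mem_nhds (by positivity))
  filter_upwards [h1, h2] with d hd1 hd2
  set s := inner ℝ a d / r with hs
  have hsr : inner ℝ a d = s * r := by rw [hs]; field_simp
  have hsD : |s| ≤ ‖d‖ := by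
    rw [hs, abs_div, abs_of_pos hr, div_le_iff₀ hr, mul_comm]
    exact abs_real_inner_le_norm a d
  set D := ‖d‖ with hD
  have hD0 : 0 ≤ D := norm_nonneg d
  have hs2 : s^2 ≤ D^2 := sq_le_sq' (by linarith [(abs_le.mp hsD).1]) (abs_le.mp hsD).2
  set S := (D^2 - s^2)/(2*r) + η * D^2 with hS
  have hS0 : 0 ≤ S := by
    have : 0 ≤ (D^2 - s^2)/(2*r) := div_nonneg (by linarith) (by positivity)
    positivity
  have hS1 : S ≤ D^2 * (1/(2*r) + η) := by
    have : (D^2 - s^2)/(2*r) ≤ D^2/(2*r) := by gcongr; nlinarith [sq_nonneg s]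
    rw [hS]; calc _ ≤ D^2/(2*r) + η * D^2 := by linarith
      _ = _ := by ring
  have hsq : ‖a + d‖^2 = r^2 + 2*(s*r) + D^2 := by
    rw [norm_add_sq_real, hsr]
  have hsS : -(r*η*D^2) ≤ s*S := by
    have h3 : |s*S| ≤ D * (D^2 * (1/(2*r)+η)) := by
      rw [abs_mul, abs_of_nonneg hS0]; gcongr
    have h4 : D * (D^2 * (1/(2*r)+η)) ≤ r*η*D^2 := by
      nlinarith [mul_le_mul_of_nonneg_left hd2.le (sq_nonneg D)]
    linarith [(abs_le.mp h3).1]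
  have hSr : 2*r*S = D^2 - s^2 + 2*r*η*D^2 := by
    rw [hS]; field_simp
  have hW : 0 ≤ r + s + S := by linarith [(abs_le.mp hsD).1]
  have : ‖a + d‖ ≤ r + s + S := by
    apply le_of_sq_le_sq _ hW |> fun h => h
    rw [hsq]
    nlinarith [sq_nonneg S]
  rw [hS] at this
  linarith

lemma exists_supconv {v : E → ℝ} {K : Set E} (hK : IsCompact K) (hne : K.Nonempty)
    (hv : ContinuousOn v K) (κ : ℝ) :
    ∃ (g : E → ℝ) (k : E → E), (∀ x, k x ∈ K) ∧
      (∀ x, g x = v (k x) + κ * inner ℝ x (k x) - κ/2 * ‖k x‖^2) ∧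
      ∀ x, ∀ w ∈ K, v w + κ * inner ℝ x w - κ/2 * ‖w‖^2 ≤ g x := by
  have : ∀ x, ∃ w ∈ K, IsMaxOn (fun w => v w + κ * inner ℝ x w - κ/2 * ‖w‖^2) K w := by
    intro x
    apply hK.exists_isMaxOn hne
    have h1 : Continuous (fun w : E => κ * inner ℝ x w) := by fun_prop
    have h2 : Continuous (fun w : E => κ/2 * ‖w‖^2) := by fun_prop
    exact (hv.add h1.continuousOn).sub h2.continuousOn
  choose k hk hmax using this
  exact ⟨fun x => v (k x) + κ * inner ℝ x (k x) - κ/2 * ‖k x‖^2, k, hk, fun x => rfl,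
    fun x w hw => hmax x hw⟩

lemma supconv_subg {v g : E → ℝ} {k : E → E} {K : Set E} {κ : ℝ} (hk : ∀ x, k x ∈ K)
    (hg : ∀ x, g x = v (k x) + κ * inner ℝ x (k x) - κ/2 * ‖k x‖^2)
    (hm : ∀ x, ∀ w ∈ K, v w + κ * inner ℝ x w - κ/2 * ‖w‖^2 ≤ g x) : HasSubg g := by
  intro z
  refine ⟨κ • k z, fun y => ?_⟩
  have := hm y (k z) (hk z)
  rw [hg z, inner_smul_left, inner_sub_right, real_inner_comm y, real_inner_comm z]
  simp only [conj_trivial]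
  linarith

lemma supconv_eq {v g : E → ℝ} {k : E → E} {κ : ℝ}
    (hg : ∀ x, g x = v (k x) + κ * inner ℝ x (k x) - κ/2 * ‖k x‖^2) (x : E) :
    g x - κ/2*‖x‖^2 = v (k x) - κ/2 * ‖x - k x‖^2 := by
  rw [hg, norm_sub_sq_real]; ring

lemma supconv_ge {v g : E → ℝ} {K : Set E} {κ : ℝ}
    (hm : ∀ x, ∀ w ∈ K, v w + κ * inner ℝ x w - κ/2 * ‖w‖^2 ≤ g x) {x : E} (hx : x ∈ K) :
    v x ≤ g x - κ/2*‖x‖^2 := by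
  have := hm x x hx
  rw [real_inner_self_eq_norm_sq] at this
  linarith

lemma supconv_transfer {v g : E → ℝ} {k : E → E} {K : Set E} {κ : ℝ}
    (hg : ∀ x, g x = v (k x) + κ * inner ℝ x (k x) - κ/2 * ‖k x‖^2)
    (hm : ∀ x, ∀ w ∈ K, v w + κ * inner ℝ x w - κ/2 * ‖w‖^2 ≤ g x) {x ζ : E} {A : E →L[ℝ] E}
    {η : ℝ}
    (hx : K ∈ 𝓝 (k x))
    (h : ∀ᶠ h in 𝓝 (0:E), g (x + h) ≤ g x + inner ℝ ζ h + 1/2 * inner ℝ (A h) h + η/2 * ‖h‖^2) :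
    ∀ᶠ h in 𝓝 (0:E), v (k x + h) ≤ v (k x) + inner ℝ (ζ - κ • x) h +
      1/2 * inner ℝ ((A + (η - κ) • ContinuousLinearMap.id ℝ E) h) h := by
  have ht : Tendsto (fun h => k x + h) (𝓝 (0:E)) (𝓝 (k x)) := by
    have : Continuous (fun h : E => k x + h) := by fun_prop
    simpa using this.tendsto 0
  filter_upwards [h, ht.eventually hx] with h h1 h2
  have h3 := hm (x + h) (k x + h) h2
  rw [hg x] at h1
  have e1 : inner ℝ (x+h) (k x + h) = inner ℝ x (k x) + inner ℝ x h + inner ℝ (k x) h + ‖h‖^2 := by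
    rw [inner_add_left, inner_add_right, inner_add_right, real_inner_self_eq_norm_sq,
      real_inner_comm (k x) h]; ring
  rw [e1, norm_add_sq_real] at h3
  simp only [_root_.add_apply, _root_.smul_apply, ContinuousLinearMap.id_apply, inner_add_left,
    inner_sub_left, inner_smul_left, conj_trivial, real_inner_self_eq_norm_sq]
  nlinarith

end SC

section SUMS
open Filter
variable {E : Type*} [NormedAddCommGroup E] [InnerProductSpace ℝ E] [FiniteDimensional ℝ E]

abbrev PP (E : Type*) := WithLp 2 (E × E)

def mkP (x y : E) : PP E := WithLp.toLp 2 (x, y)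

lemma mkP_fst (x y : E) : (mkP x y).fst = x := rfl
lemma mkP_snd (x y : E) : (mkP x y).snd = y := rfl
lemma inner_PP (z w : PP E) : inner ℝ z w = inner ℝ z.fst w.fst + inner ℝ z.snd w.snd :=
  WithLp.prod_inner_apply z w
lemma normsq_PP (z : PP E) : ‖z‖^2 = ‖z.fst‖^2 + ‖z.snd‖^2 := WithLp.prod_norm_sq_eq_of_L2 z
lemma fst_le_PP (z : PP E) : ‖z.fst‖ ≤ ‖z‖ := by
  apply le_of_sq_le_sq _ (norm_nonneg _)
  rw [normsq_PP]; nlinarith [sq_nonneg ‖z.snd‖]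
lemma snd_le_PP (z : PP E) : ‖z.snd‖ ≤ ‖z‖ := by
  apply le_of_sq_le_sq _ (norm_nonneg _)
  rw [normsq_PP]; nlinarith [sq_nonneg ‖z.fst‖]

def QP (N : E →L[ℝ] E) (τ : ℝ) : PP E →L[ℝ] PP E :=
  LinearMap.toContinuousLinearMap
    { toFun := fun z => mkP (N (z.fst - z.snd) + τ • z.fst) (-N (z.fst - z.snd) + τ • z.snd)
      map_add' := by
        intro a b
        apply (WithLp.equiv 2 (E × E)).injective
        ext <;> simp [mkP] <;> abel
      map_smul' := by
        intro c a
        apply (WithLp.equiv 2 (E × E)).injective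
        ext
        · simp [mkP, smul_sub, smul_comm c τ]
        · simp [mkP, smul_sub, smul_comm c τ] }

lemma QP_apply (N : E →L[ℝ] E) (τ : ℝ) (z : PP E) : QP N τ z =
    mkP (N (z.fst - z.snd) + τ • z.fst) (-N (z.fst - z.snd) + τ • z.snd) := rfl

def blk1 (A : PP E →L[ℝ] PP E) : E →L[ℝ] E :=
  LinearMap.toContinuousLinearMap
    { toFun := fun x => (A (mkP x 0)).fst
      map_add' := by
        intro a b
        have : mkP (a+b) (0:E) = mkP a 0 + mkP b 0 := by
          apply (WithLp.equiv 2 (E × E)).injective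
          ext <;> simp [mkP]
        rw [this]; simp
      map_smul' := by
        intro c a
        have : mkP (c • a) (0:E) = c • mkP a 0 := by
          apply (WithLp.equiv 2 (E × E)).injective
          ext <;> simp [mkP]
        rw [this]; simp }

def blk2 (A : PP E →L[ℝ] PP E) : E →L[ℝ] E :=
  LinearMap.toContinuousLinearMap
    { toFun := fun x => (A (mkP 0 x)).snd
      map_add' := by
        intro a b
        have : mkP (0:E) (a+b) = mkP 0 a + mkP 0 b := by
          apply (WithLp.equiv 2 (E × E)).injective
          ext <;> simp [mkP]
        rw [this]; simp
      map_smul' := by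
        intro c a
        have : mkP (0:E) (c • a) = c • mkP 0 a := by
          apply (WithLp.equiv 2 (E × E)).injective
          ext <;> simp [mkP]
        rw [this]; simp }

lemma blk1_inner (A : PP E →L[ℝ] PP E) (h : E) :
    inner ℝ (A (mkP h 0)) (mkP h 0) = inner ℝ (blk1 A h) h := by
  rw [inner_PP, mkP_fst, mkP_snd, inner_zero_right, add_zero]; rfl

lemma blk2_inner (A : PP E →L[ℝ] PP E) (h : E) :
    inner ℝ (A (mkP 0 h)) (mkP 0 h) = inner ℝ (blk2 A h) h := by
  rw [inner_PP, mkP_fst, mkP_snd, inner_zero_right, zero_add]; rfl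

lemma mkP_cont : Continuous (fun z : E × E => mkP z.1 z.2) := by
  unfold mkP
  exact WithLp.prod_continuous_toLp 2 E E

theorem sums_lemma {g1 g2 : E → ℝ} (h1 : HasSubg g1) (h2 : HasSubg g2) (x0 y0 b1 b2 : E)
    (N : E →L[ℝ] E) (hN : ∀ x y, inner ℝ (N x) y = inner ℝ x (N y)) (τ : ℝ)
    (hloc : ∀ᶠ h in 𝓝 (0:E × E), g1 (x0 + h.1) + g2 (y0 + h.2) ≤ g1 x0 + g2 y0
      + inner ℝ b1 h.1 + inner ℝ b2 h.2
      + 1/2 * (inner ℝ (N (h.1 - h.2)) (h.1 - h.2) + τ * (‖h.1‖^2 + ‖h.2‖^2)))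
    {η : ℝ} (hη : 0 < η) :
    ∃ (x y ζ1 ζ2 : E) (A1 A2 : E →L[ℝ] E), ‖x - x0‖ < η ∧ ‖y - y0‖ < η ∧ ‖ζ1 - b1‖ < η ∧
      ‖ζ2 - b2‖ < η ∧
      (∀ h1 h2, inner ℝ (A1 h1) h1 + inner ℝ (A2 h2) h2 ≤ inner ℝ (N (h1 - h2)) (h1 - h2)
        + (τ + η) * (‖h1‖^2 + ‖h2‖^2)) ∧
      (∀ ε > 0, ∀ᶠ h in 𝓝 (0:E),
        g1 (x + h) ≤ g1 x + inner ℝ ζ1 h + 1/2 * inner ℝ (A1 h) h + ε * ‖h‖^2) ∧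
      (∀ ε > 0, ∀ᶠ h in 𝓝 (0:E),
        g2 (y + h) ≤ g2 y + inner ℝ ζ2 h + 1/2 * inner ℝ (A2 h) h + ε * ‖h‖^2) := by
  let f : PP E → ℝ := fun z => g1 z.fst + g2 z.snd
  have hf : HasSubg f := by
    intro z
    obtain ⟨a, ha⟩ := h1 z.fst
    obtain ⟨b, hb⟩ := h2 z.snd
    refine ⟨mkP a b, fun y => ?_⟩
    have := ha y.fst
    have := hb y.snd
    rw [inner_PP]
    simp only [mkP_fst, mkP_snd, WithLp.sub_fst, WithLp.sub_snd, f]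
    linarith
  have hQ : ∀ x y, inner ℝ (QP N τ x) y = inner ℝ x (QP N τ y) := by
    intro x y
    have h := hN (x.fst - x.snd) (y.fst - y.snd)
    rw [inner_PP, inner_PP, QP_apply, QP_apply]
    simp only [mkP_fst, mkP_snd, inner_add_left, inner_add_right, inner_neg_left, inner_neg_right,
      inner_smul_left, inner_smul_right, conj_trivial]
    rw [inner_sub_right, inner_sub_left (x.fst)] at h
    linarith
  have hQq : ∀ h, inner ℝ (QP N τ h) h = inner ℝ (N (h.fst - h.snd)) (h.fst - h.snd)
      + τ * (‖h.fst‖^2 + ‖h.snd‖^2) := by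
    intro h
    rw [inner_PP, QP_apply]
    simp only [mkP_fst, mkP_snd, inner_add_left, inner_neg_left,
      inner_smul_left, conj_trivial, real_inner_self_eq_norm_sq, inner_sub_right]
    ring
  have hloc' : ∀ᶠ h in 𝓝 (0:PP E), f (mkP x0 y0 + h) ≤ f (mkP x0 y0)
      + inner ℝ (mkP b1 b2) h + 1/2 * inner ℝ (QP N τ h) h := by
    have ht : Tendsto (fun h : PP E => (h.fst, h.snd)) (𝓝 0) (𝓝 (0 : E × E)) := by
      have : Continuous (fun h : PP E => (h.fst, h.snd)) := WithLp.prod_continuous_ofLp 2 E E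
      exact this.tendsto 0
    filter_upwards [ht.eventually hloc] with h hh
    rw [hQq, inner_PP]
    simp only [mkP_fst, mkP_snd, f, WithLp.add_fst, WithLp.add_snd]
    linarith
  obtain ⟨z, ζ, A, hz, hζ, hA, hexp⟩ := jensen_alexandrov hf (mkP x0 y0) (mkP b1 b2) (QP N τ) hQ hloc' hη
  have hA1 : ∀ ε > 0, ∀ᶠ h in 𝓝 (0:E), |g1 (z.fst + h) - g1 z.fst - inner ℝ ζ.fst h
      - 1/2 * inner ℝ (blk1 A h) h| ≤ ε * ‖h‖^2 := by
    intro ε hε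
    have ht : Tendsto (fun h : E => mkP h 0) (𝓝 0) (𝓝 (0 : PP E)) := by
      have : Continuous (fun h : E => mkP h (0:E)) :=
        mkP_cont.comp (by fun_prop : Continuous (fun h : E => (h, (0:E))))
      exact this.tendsto 0
    filter_upwards [ht.eventually (hexp ε hε)] with h hh
    rw [blk1_inner, inner_PP, normsq_PP] at hh
    simp only [f, mkP_fst, mkP_snd, WithLp.add_fst, WithLp.add_snd, add_zero, inner_zero_right,
      norm_zero] at hh
    refine le_trans (le_of_eq ?_) (hh.trans (le_of_eq (by ring)))
    congr 1; ring
  have hA2 : ∀ ε > 0, ∀ᶠ h in 𝓝 (0:E), |g2 (z.snd + h) - g2 z.snd - inner ℝ ζ.snd h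
      - 1/2 * inner ℝ (blk2 A h) h| ≤ ε * ‖h‖^2 := by
    intro ε hε
    have ht : Tendsto (fun h : E => mkP 0 h) (𝓝 0) (𝓝 (0 : PP E)) := by
      have : Continuous (fun h : E => mkP (0:E) h) :=
        mkP_cont.comp (by fun_prop : Continuous (fun h : E => ((0:E), h)))
      exact this.tendsto 0
    filter_upwards [ht.eventually (hexp ε hε)] with h hh
    rw [blk2_inner, inner_PP, normsq_PP] at hh
    simp only [f, mkP_fst, mkP_snd, WithLp.add_fst, WithLp.add_snd, add_zero, inner_zero_right,
      norm_zero, zero_add] at hh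
    refine le_trans (le_of_eq ?_) (hh.trans (le_of_eq (by ring)))
    congr 1; ring
  have hsep : ∀ k1 k2, inner ℝ (A (mkP k1 k2)) (mkP k1 k2) =
      inner ℝ (blk1 A k1) k1 + inner ℝ (blk2 A k2) k2 := by
    intro k1 k2
    set q := inner ℝ (A (mkP k1 k2)) (mkP k1 k2)
    set q1 := inner ℝ (blk1 A k1) k1
    set q2 := inner ℝ (blk2 A k2) k2
    set m := ‖k1‖^2 + ‖k2‖^2
    have hm : 0 ≤ m := by positivity
    have key : ∀ ε > 0, |q - (q1 + q2)| ≤ ε * (4 * m) := by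
      intro ε hε
      have t1 : Tendsto (fun t : ℝ => t • k1) (𝓝 0) (𝓝 (0:E)) := by
        have : Continuous (fun t : ℝ => t • k1) := by fun_prop
        simpa using this.tendsto 0
      have t2 : Tendsto (fun t : ℝ => t • k2) (𝓝 0) (𝓝 (0:E)) := by
        have : Continuous (fun t : ℝ => t • k2) := by fun_prop
        simpa using this.tendsto 0
      have t3 : Tendsto (fun t : ℝ => t • mkP k1 k2) (𝓝 0) (𝓝 (0:PP E)) := by
        have : Continuous (fun t : ℝ => t • mkP k1 k2) := by fun_prop
        simpa using this.tendsto 0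
      have ev := ((t1.eventually (hA1 ε hε)).and (t2.eventually (hA2 ε hε))).and
        (t3.eventually (hexp ε hε))
      have ev' := (ev.filter_mono (nhdsWithin_le_nhds (s := Ioi 0))).and
        (self_mem_nhdsWithin : Ioi (0:ℝ) ∈ 𝓝[>] 0)
      obtain ⟨t, ⟨⟨e1, e2⟩, e3⟩, ht⟩ := ev'.exists
      have ht0 : 0 < t := ht
      rw [inner_PP ζ, normsq_PP] at e3
      simp only [map_smul, inner_smul_left, inner_smul_right, conj_trivial, WithLp.smul_fst,
        WithLp.smul_snd, mkP_fst, mkP_snd, f, WithLp.add_fst, WithLp.add_snd, norm_smul,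
        mul_pow, Real.norm_eq_abs, sq_abs] at e1 e2 e3
      change |_ - _ - _ - 1/2 * (t * (t * q1))| ≤ _ at e1
      change |_ - _ - _ - 1/2 * (t * (t * q2))| ≤ _ at e2
      change |_ - _ - _ - 1/2 * (t * (t * q))| ≤ _ at e3
      rw [abs_le] at e1 e2 e3
      have htt : 0 < t^2 := by positivity
      have hmm : ε * (t^2*‖k1‖^2) + ε * (t^2 * ‖k2‖^2) = t^2 * (ε * m) := by
        simp only [m]; ring
      rw [abs_le]
      constructor
      · have : t^2 * (-(ε * (4*m))) ≤ t^2 * (q - (q1+q2)) := by nlinarith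
        exact le_of_mul_le_mul_left this htt
      · have : t^2 * (q - (q1+q2)) ≤ t^2 * (ε * (4*m)) := by nlinarith
        exact le_of_mul_le_mul_left this htt
    have : |q - (q1+q2)| ≤ 0 := by
      apply le_of_forall_pos_le_add
      intro ε hε
      have := key (ε / (4*m+1)) (by positivity)
      refine this.trans ?_
      rw [zero_add, div_mul_eq_mul_div, div_le_iff₀ (by positivity)]
      nlinarith
    have := abs_nonpos_iff.mp this
    linarith
  refine ⟨z.fst, z.snd, ζ.fst, ζ.snd, blk1 A, blk2 A, (fst_le_PP (z - mkP x0 y0)).trans_lt hz,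
    (snd_le_PP (z - mkP x0 y0)).trans_lt hz, (fst_le_PP (ζ - mkP b1 b2)).trans_lt hζ,
    (snd_le_PP (ζ - mkP b1 b2)).trans_lt hζ, ?_, ?_, ?_⟩
  · intro k1 k2
    rw [← hsep]
    have := hA (mkP k1 k2)
    rw [hQq, normsq_PP] at this
    simp only [mkP_fst, mkP_snd] at this
    linarith
  · intro ε hε
    filter_upwards [hA1 ε hε] with h hh
    linarith [(abs_le.mp hh).2]
  · intro ε hε
    filter_upwards [hA2 ε hε] with h hh
    linarith [(abs_le.mp hh).2]

end SUMS

section CORE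
open Filter
variable {E : Type*} [NormedAddCommGroup E] [InnerProductSpace ℝ E] [FiniteDimensional ℝ E]

def NN (L1 r : ℝ) (a : E) : E →L[ℝ] E :=
  LinearMap.toContinuousLinearMap
    { toFun := fun d => (L1 * (1/r - 1/4)) • d - (L1 / r^3 * inner ℝ a d) • a
      map_add' := by
        intro x y
        rw [inner_add_right, mul_add, add_smul, smul_add]; abel
      map_smul' := by
        intro c x
        simp only [RingHom.id_apply, inner_smul_right, smul_sub, smul_smul]
        congr 2 <;> ring }

lemma NN_inner (L1 r : ℝ) (a x y : E) : inner ℝ (NN L1 r a x) y =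
    L1 * (1/r - 1/4) * inner ℝ x y - L1 / r^3 * inner ℝ a x * inner ℝ a y := by
  change inner ℝ ((L1 * (1/r - 1/4)) • x - (L1 / r^3 * inner ℝ a x) • a) y = _
  rw [inner_sub_left, inner_smul_left, inner_smul_left]; simp

lemma supconv_close {v g : E → ℝ} {k : E → E} {K : Set E} {κ M δ : ℝ} (hκ : 0 < κ) (hδ : 0 < δ)
    (hk : ∀ x, k x ∈ K)
    (hg : ∀ x, g x = v (k x) + κ * inner ℝ x (k x) - κ/2 * ‖k x‖^2)
    (hm : ∀ x, ∀ w ∈ K, v w + κ * inner ℝ x w - κ/2 * ‖w‖^2 ≤ g x)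
    (hM : ∀ x ∈ K, |v x| ≤ M) (hκδ : 4 * M < κ * δ^2) {x : E} (hx : x ∈ K) : ‖x - k x‖ < δ := by
  have h1 := supconv_ge hm hx
  rw [supconv_eq hg] at h1
  have h2 := abs_le.mp (hM x hx)
  have h3 := abs_le.mp (hM _ (hk x))
  have h4 : κ * ‖x - k x‖^2 < κ * δ^2 := by nlinarith
  exact lt_of_pow_lt_pow_left₀ 2 hδ.le (lt_of_mul_lt_mul_left h4 hκ.le)

set_option maxHeartbeats 1000000 in
theorem core_touch {u : E → ℝ} {x0 : E} {R M L1 L2 : ℝ} (hR : 0 < R) (hR1 : 4 * R < 1)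
    (hu : ContinuousOn u (closedBall x0 (3*R))) (hM : ∀ x ∈ closedBall x0 (3*R), |u x| ≤ M)
    (hL2 : 0 < L2) (hL2M : 2 * M < L2 * (2*R)^2) (hL1 : 0 < L1) (hL12 : 4*L2*R + 2 ≤ L1/2)
    {x1 y1 : E} (hx1 : x1 ∈ closedBall x0 (2*R)) (hy1 : y1 ∈ closedBall x0 (2*R))
    (hbad : L1 * (‖x1-y1‖ - ‖x1-y1‖^2/4) + L2 * (‖x1-x0‖^2 + ‖y1-x0‖^2) < u x1 - u y1) :
    ∃ (x y p1 p2 e : E) (T1 T2 : E →L[ℝ] E), x ∈ ball x0 (3*R) ∧ y ∈ ball x0 (3*R) ∧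
      1 ≤ ‖p1‖ ∧ 1 ≤ ‖p2‖ ∧ ‖e‖ = 1 ∧
      (∀ᶠ h in 𝓝 (0:E), u (x + h) ≤ u x + inner ℝ p1 h + 1/2 * inner ℝ (T1 h) h) ∧
      (∀ᶠ h in 𝓝 (0:E), -u (y + h) ≤ -u y + inner ℝ p2 h + 1/2 * inner ℝ (T2 h) h) ∧
      (∀ ξ, inner ℝ (T1 ξ) ξ + inner ℝ (T2 ξ) ξ ≤ (4*L2+1) * ‖ξ‖^2) ∧
      inner ℝ (T1 e) e + inner ℝ (T2 e) e ≤ -(L1 - 4*L2 - 1) := by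
  have hKc : IsCompact (closedBall x0 (3*R)) := isCompact_closedBall x0 (3*R)
  have hKs : closedBall x0 (2*R) ⊆ closedBall x0 (3*R) := closedBall_subset_closedBall (by linarith)
  have hne : (closedBall x0 (3*R)).Nonempty := ⟨x1, hKs hx1⟩
  have hM0 : 0 ≤ M := (abs_nonneg _).trans (hM _ (hKs hx1))
  let Φ : E → E → ℝ := fun x y => L1 * (‖x-y‖ - ‖x-y‖^2/4) + L2 * (‖x-x0‖^2 + ‖y-x0‖^2)
  set θ := u x1 - u y1 - Φ x1 y1 with hθ
  have hθ0 : 0 < θ := by simp only [hθ, Φ]; linarith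
  -- uniform continuity
  have huc := hKc.uniformContinuousOn_of_continuous hu
  rw [Metric.uniformContinuousOn_iff] at huc
  obtain ⟨δ0, hδ0, huc⟩ := huc θ hθ0
  set δ := min (δ0/2) (R/2) with hδdef
  have hδ : 0 < δ := lt_min (by linarith) (by linarith)
  have hδ1 : δ ≤ δ0/2 := min_le_left _ _
  have hδ2 : δ ≤ R/2 := min_le_right _ _
  set κ := (4*M+1)/δ^2 with hκdef
  have hκ : 0 < κ := by positivity
  have hκδ : 4*M < κ * δ^2 := by
    rw [hκdef, div_mul_cancel₀ _ (by positivity)]; linarith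
  obtain ⟨g1, k1, hk1, hg1, hm1⟩ := exists_supconv hKc hne hu κ
  obtain ⟨g2, k2, hk2, hg2, hm2⟩ := exists_supconv hKc hne hu.neg κ
  have hM2 : ∀ x ∈ closedBall x0 (3*R), |(-u) x| ≤ M := by
    intro x hx; rw [Pi.neg_apply, abs_neg]; exact hM x hx
  have hs1 := supconv_subg hk1 hg1 hm1
  have hs2 := supconv_subg hk2 hg2 hm2
  -- maximum point
  let Ψ : E × E → ℝ := fun z => (g1 z.1 - κ/2*‖z.1‖^2) + (g2 z.2 - κ/2*‖z.2‖^2) - Φ z.1 z.2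
  have hΨ : Continuous Ψ := by
    have c1 := hs1.continuous
    have c2 := hs2.continuous
    simp only [Ψ, Φ]
    fun_prop
  have hcomp : IsCompact (closedBall x0 (2*R) ×ˢ closedBall x0 (2*R)) :=
    (isCompact_closedBall x0 (2*R)).prod (isCompact_closedBall x0 (2*R))
  obtain ⟨⟨xh, yh⟩, hmem, hmax⟩ := hcomp.exists_isMaxOn ⟨(x1, y1), hx1, hy1⟩ hΨ.continuousOn
  obtain ⟨hxh, hyh⟩ : xh ∈ closedBall x0 (2*R) ∧ yh ∈ closedBall x0 (2*R) := hmem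
  have hΨθ : θ ≤ Ψ (xh, yh) := by
    refine le_trans ?_ (hmax (show (x1, y1) ∈ _ from ⟨hx1, hy1⟩))
    have i1 := supconv_ge hm1 (hKs hx1)
    have i2 := supconv_ge hm2 (hKs hy1)
    simp only [Pi.neg_apply] at i2
    simp only [Ψ, hθ]
    linarith
  have v1 : g1 xh - κ/2*‖xh‖^2 ≤ u (k1 xh) := by
    rw [supconv_eq hg1]; linarith [mul_nonneg hκ.le (sq_nonneg ‖xh - k1 xh‖)]
  have v2 : g2 yh - κ/2*‖yh‖^2 ≤ -u (k2 yh) := by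
    rw [supconv_eq hg2]
    have := mul_nonneg hκ.le (sq_nonneg ‖yh - k2 yh‖)
    simp only [Pi.neg_apply]
    linarith
  have hΦle : θ + Φ xh yh ≤ u (k1 xh) - u (k2 yh) := by
    simp only [Ψ] at hΨθ
    linarith
  have hxh' : ‖xh - x0‖ ≤ 2*R := by simpa [dist_eq_norm] using hxh
  have hyh' : ‖yh - x0‖ ≤ 2*R := by simpa [dist_eq_norm] using hyh
  have hr1 : ‖xh - yh‖ < 1 := by
    have : xh - yh = (xh - x0) - (yh - x0) := by abel
    rw [this]
    exact (norm_sub_le _ _).trans_lt (by linarith)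
  have hω : 0 ≤ L1 * (‖xh-yh‖ - ‖xh-yh‖^2/4) := by
    have := norm_nonneg (xh - yh)
    apply mul_nonneg hL1.le
    nlinarith
  have hint : L2 * (‖xh-x0‖^2 + ‖yh-x0‖^2) < L2 * (2*R)^2 := by
    have j1 := abs_le.mp (hM _ (hk1 xh))
    have j2 := abs_le.mp (hM _ (hk2 yh))
    simp only [Φ] at hΦle
    linarith
  have hint' := lt_of_mul_lt_mul_left hint hL2.le
  have hxi : ‖xh - x0‖ < 2*R := lt_of_pow_lt_pow_left₀ 2 (by positivity)
    (by linarith [sq_nonneg ‖yh - x0‖])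
  have hyi : ‖yh - x0‖ < 2*R := lt_of_pow_lt_pow_left₀ 2 (by positivity)
    (by linarith [sq_nonneg ‖xh - x0‖])
  have hxne : xh - yh ≠ 0 := by
    intro h0
    have hxy : xh = yh := sub_eq_zero.mp h0
    have d1 := supconv_close hκ hδ hk1 hg1 hm1 hM hκδ (hKs hxh)
    have d2 := supconv_close hκ hδ hk2 hg2 hm2 hM2 hκδ (hKs hyh)
    have d3 : dist (k1 xh) (k2 yh) < δ0 := by
      rw [dist_eq_norm]
      have : k1 xh - k2 yh = (yh - k2 yh) - (xh - k1 xh) := by rw [hxy]; abel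
      rw [this]
      exact (norm_sub_le _ _).trans_lt (by linarith)
    have d4 := huc _ (hk1 xh) _ (hk2 yh) d3
    rw [Real.dist_eq] at d4
    have d5 := (abs_lt.mp d4).2
    have : 0 ≤ Φ xh yh := by
      simp only [Φ]
      have : 0 ≤ L2 * (‖xh-x0‖^2 + ‖yh-x0‖^2) := by positivity
      linarith
    linarith
  set a := xh - yh with ha
  set r := ‖a‖ with hr
  have hr0 : 0 < r := norm_pos_iff.mpr hxne
  set c := L1 * (1/r - 1/2) with hc
  set w := c • a with hw
  have hwn : L1/2 ≤ ‖w‖ := by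
    have hinv : 1 < 1/r := by rw [lt_div_iff₀ hr0]; linarith
    have : 0 ≤ c := mul_nonneg hL1.le (by linarith)
    rw [hw, norm_smul, Real.norm_of_nonneg this, ← hr, hc]
    have : L1 * (1/r - 1/2) * r = L1 * (1 - r/2) := by field_simp
    rw [this]; linarith [mul_le_mul_of_nonneg_left hr1.le hL1.le]
  -- local bound
  have hloc : ∀ᶠ h in 𝓝 (0:E × E), g1 (xh + h.1) + g2 (yh + h.2) ≤ g1 xh + g2 yh
      + inner ℝ (w + (2*L2) • (xh - x0) + κ • xh) h.1
      + inner ℝ (-w + (2*L2) • (yh - x0) + κ • yh) h.2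
      + 1/2 * (inner ℝ (NN L1 r a (h.1 - h.2)) (h.1 - h.2)
        + (2*L2 + κ) * (‖h.1‖^2 + ‖h.2‖^2)) := by
    have t1 : Tendsto (fun h : E × E => h.1 - h.2) (𝓝 0) (𝓝 (0:E)) := by
      have : Continuous (fun h : E × E => h.1 - h.2) := by fun_prop
      simpa using this.tendsto 0
    have t2 : ∀ᶠ h in 𝓝 (0:E × E), ‖xh + h.1 - x0‖ < 2*R := by
      have : Continuous (fun h : E × E => ‖xh + h.1 - x0‖) := by fun_prop
      exact (this.tendsto 0).eventually (gt_mem_nhds (by simpa using hxi))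
    have t3 : ∀ᶠ h in 𝓝 (0:E × E), ‖yh + h.2 - x0‖ < 2*R := by
      have : Continuous (fun h : E × E => ‖yh + h.2 - x0‖) := by fun_prop
      exact (this.tendsto 0).eventually (gt_mem_nhds (by simpa using hyi))
    filter_upwards [t1.eventually (norm_quad_bound hxne (by norm_num : (0:ℝ) < 1/8)), t2, t3]
      with h q1 q2 q3
    obtain ⟨h1, h2⟩ := h
    simp only at q1 q2 q3 ⊢
    have hmx := hmax (show (xh + h1, yh + h2) ∈ _ from
      ⟨by simpa [dist_eq_norm] using q2.le, by simpa [dist_eq_norm] using q3.le⟩)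
    simp only [Ψ, Φ, Set.mem_ofPred_eq] at hmx
    rw [← hr] at q1
    set d := h1 - h2 with hd
    have e0 : xh + h1 - (yh + h2) = a + d := by rw [ha, hd]; abel
    have e1 : xh + h1 - x0 = (xh - x0) + h1 := by abel
    have e2 : yh + h2 - x0 = (yh - x0) + h2 := by abel
    rw [e0, e1, e2, norm_add_sq_real xh, norm_add_sq_real yh, norm_add_sq_real (xh - x0),
      norm_add_sq_real (yh - x0), norm_add_sq_real a, ← ha, ← hr] at hmx
    rw [NN_inner, real_inner_self_eq_norm_sq]
    simp only [inner_add_left, inner_neg_left, inner_smul_left, conj_trivial, hw]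
    have e3 : inner ℝ a h1 = inner ℝ a d + inner ℝ a h2 := by
      rw [hd, inner_sub_right]; ring
    rw [e3, hc]
    have q1' := mul_le_mul_of_nonneg_left q1 hL1.le
    have e4 : L1 * (r + inner ℝ a d / r + (‖d‖^2 - (inner ℝ a d / r)^2)/(2*r) + 1/8*‖d‖^2)
      = L1 * r + L1 * (1/r) * inner ℝ a d + 1/2 * (L1 * (1/r) * ‖d‖^2)
        - 1/2 * (L1/r^3 * inner ℝ a d * inner ℝ a d) + L1 * (1/8) * ‖d‖^2 := by
      field_simp
      ring
    rw [e4] at q1'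
    linarith
  set η := min (min (1/4) (R/2)) (1/(1+κ)) with hη
  have hη0 : 0 < η := by
    refine lt_min (lt_min (by norm_num) (by linarith)) (by positivity)
  have hη1 : η ≤ 1/4 := (min_le_left _ _).trans (min_le_left _ _)
  have hη2 : η ≤ R/2 := (min_le_left _ _).trans (min_le_right _ _)
  have hη3 : η * (1+κ) ≤ 1 := by
    have : η ≤ 1/(1+κ) := min_le_right _ _
    rwa [le_div_iff₀ (by positivity)] at this
  have hNs : ∀ x y, inner ℝ (NN L1 r a x) y = inner ℝ x (NN L1 r a y) := by
    intro x y
    rw [real_inner_comm (NN L1 r a y) x, NN_inner, NN_inner, real_inner_comm x y]; ring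
  obtain ⟨x, y, ζ1, ζ2, A1, A2, hx, hy, hζ1, hζ2, hA, hj1, hj2⟩ :=
    sums_lemma hs1 hs2 xh yh _ _ (NN L1 r a) hNs (2*L2+κ) hloc hη0
  have inball : ∀ z zh : E, ‖z - zh‖ < η → ‖zh - x0‖ < 2*R → ‖z - x0‖ < 5/2*R := by
    intro z zh h1 h2
    have : z - x0 = (z - zh) + (zh - x0) := by abel
    rw [this]; exact (norm_add_le _ _).trans_lt (by linarith)
  have hxK := inball x xh hx hxi
  have hyK := inball y yh hy hyi
  have memK : ∀ z : E, ‖z - x0‖ < 5/2*R → z ∈ closedBall x0 (3*R) := by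
    intro z hz
    rw [mem_closedBall, dist_eq_norm]; linarith
  have d1 := supconv_close hκ hδ hk1 hg1 hm1 hM hκδ (memK x hxK)
  have d2 := supconv_close hκ hδ hk2 hg2 hm2 hM2 hκδ (memK y hyK)
  have kin : ∀ z k : E, ‖z - x0‖ < 5/2*R → ‖z - k‖ < δ → k ∈ ball x0 (3*R) := by
    intro z k h1 h2
    rw [mem_ball, dist_eq_norm]
    have : k - x0 = (z - x0) - (z - k) := by abel
    rw [this]; exact (norm_sub_le _ _).trans_lt (by linarith)
  have k1in := kin _ _ hxK d1
  have k2in := kin _ _ hyK d2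
  have n1 : closedBall x0 (3*R) ∈ 𝓝 (k1 x) :=
    mem_of_superset (isOpen_ball.mem_nhds k1in) ball_subset_closedBall
  have n2 : closedBall x0 (3*R) ∈ 𝓝 (k2 y) :=
    mem_of_superset (isOpen_ball.mem_nhds k2in) ball_subset_closedBall
  have tr1 := supconv_transfer hg1 hm1 n1 (hj1 (η/2) (by positivity))
  have tr2 := supconv_transfer hg2 hm2 n2 (hj2 (η/2) (by positivity))
  have grad : ∀ (ζ z zh w' : E), ‖ζ - (w' + (2*L2) • (zh - x0) + κ • zh)‖ < η → ‖z - zh‖ < η →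
      ‖zh - x0‖ < 2*R → L1/2 ≤ ‖w'‖ → 1 ≤ ‖ζ - κ • z‖ := by
    intro ζ z zh w' h1 h2 h3 h4
    have e : w' = (ζ - κ • z) - (ζ - (w' + (2*L2) • (zh - x0) + κ • zh)) + κ • (z - zh)
        - (2*L2) • (zh - x0) := by
      rw [smul_sub κ]; abel
    have b1 : ‖κ • (z - zh)‖ ≤ κ * η := by
      rw [norm_smul, Real.norm_of_nonneg hκ.le]; gcongr
    have b2 : ‖(2*L2) • (zh - x0)‖ ≤ 2*L2*(2*R) := by
      rw [norm_smul, Real.norm_of_nonneg (by positivity)]; gcongr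
    have b3 : ‖w'‖ ≤ ‖ζ - κ • z‖ + η + κ * η + 2*L2*(2*R) := by
      conv_lhs => rw [e]
      refine (norm_sub_le _ _).trans (add_le_add ((norm_add_le _ _).trans (add_le_add
        ((norm_sub_le _ _).trans (add_le_add le_rfl h1.le)) b1)) b2)
    linarith
  have quad : ∀ (A : E →L[ℝ] E) (ξ : E),
      inner ℝ ((A + (η - κ) • ContinuousLinearMap.id ℝ E) ξ) ξ = inner ℝ (A ξ) ξ + (η-κ)*‖ξ‖^2 := by
    intro A ξ
    simp only [_root_.add_apply, _root_.smul_apply, ContinuousLinearMap.id_apply, inner_add_left,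
      inner_smul_left, conj_trivial, real_inner_self_eq_norm_sq]
  have he : ‖(1/r) • a‖ = 1 := by
    rw [norm_smul, Real.norm_of_nonneg (by positivity), ← hr]; field_simp
  refine ⟨k1 x, k2 y, _, _, (1/r) • a, _, _, k1in, k2in, grad ζ1 x xh w hζ1 hx hxi hwn,
    grad ζ2 y yh (-w) hζ2 hy hyi (by rwa [norm_neg]), he, tr1, tr2, ?_, ?_⟩
  · intro ξ
    rw [quad, quad]
    have := hA ξ ξ
    rw [sub_self, map_zero, inner_zero_left] at this
    have h5 := mul_le_mul_of_nonneg_right hη1 (sq_nonneg ‖ξ‖)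
    linarith
  · rw [quad, quad]
    set e := (1/r) • a with hedef
    have := hA e (-e)
    rw [NN_inner, norm_neg, he, sub_neg_eq_add, map_neg, inner_neg_neg] at this
    have i1 : inner ℝ (e+e) (e+e) = (4:ℝ) := by
      rw [inner_add_left, inner_add_right, real_inner_self_eq_norm_sq, he]; norm_num
    have i2 : inner ℝ a (e+e) = 2*r := by
      rw [inner_add_right, hedef, inner_smul_right, real_inner_self_eq_norm_sq, ← hr]
      field_simp; norm_num
    rw [i1, i2] at this
    have i3 : L1 * (1/r - 1/4) * 4 - L1/r^3 * (2*r) * (2*r) = -L1 := by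
      field_simp; ring
    rw [he]
    linarith

end CORE

section FIN
open Filter

lemma lip_core {n : ℕ} {lam Lam : ℝ} (hlam : 0 < lam) (hlL : lam ≤ Lam) {ρ : ℝ} (hρ : 0 < ρ)
    (hρ2 : ρ < 1/2) {Mu Mf L1 L2 : ℝ} (hMu0 : 0 ≤ Mu) (hMf0 : 0 ≤ Mf)
    (hL2 : L2 = (2*Mu+1)/(ρ/4)^2)
    (hL1 : L1 = 4*L2*ρ + 4 + 4*L2 + 1 + (Lam * n * (4*L2+1) + 2*(Mu+Mf))/lam + 1)
    {Ω : Set (En n)} {F : Mat n → ℝ} (hF : UniformlyElliptic lam Lam F) {μ : ℝ}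
    (hμ : μ ∈ Icc (0:ℝ) 1) {p q s a b f u : En n → ℝ} (hp : ∀ x ∈ Ω, 0 ≤ p x)
    (ha : ∀ x ∈ Ω, 0 ≤ a x) (hb : ∀ x ∈ Ω, 0 ≤ b x) (hu : ContinuousOn u Ω)
    (hsol : ViscSolOn Ω (mpOp F μ p q s a b f) u) {z₀ : En n} (hball : closedBall z₀ ρ ⊆ Ω)
    (hMu : ∀ x ∈ ball z₀ ρ, |u x| ≤ Mu) (hMf : ∀ x ∈ ball z₀ ρ, |f x| ≤ Mf)
    {x0 : En n} (hx0 : x0 ∈ ball z₀ (ρ/2)) {x y : En n} (hx : x ∈ closedBall x0 (ρ/4))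
    (hy : y ∈ closedBall x0 (ρ/4)) :
    u x - u y ≤ L1 * (‖x-y‖ - ‖x-y‖^2/4) + L2 * (‖x-x0‖^2 + ‖y-x0‖^2) := by
  by_contra hcon
  push Not at hcon
  have hL2p : 0 < L2 := by rw [hL2]; positivity
  have hLam : 0 ≤ Lam := hlam.le.trans hlL
  have hfr : 0 ≤ (Lam * n * (4*L2+1) + 2*(Mu+Mf))/lam := by positivity
  have hsub : closedBall x0 (3*(ρ/8)) ⊆ ball z₀ ρ := by
    intro w hw
    rw [mem_ball] at hx0 ⊢
    rw [mem_closedBall] at hw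
    linarith [dist_triangle w x0 z₀]
  have hsubΩ : ball z₀ ρ ⊆ Ω := ball_subset_closedBall.trans hball
  have hL1p : 0 < L1 := by rw [hL1]; positivity
  obtain ⟨xs, ys, p1, p2, e, T1, T2, hxs, hys, hp1, hp2, he, t1, t2, hT, hTe⟩ :=
    core_touch (u := u) (x0 := x0) (R := ρ/8) (M := Mu) (L1 := L1) (L2 := L2) (by positivity)
      (by linarith) (hu.mono (hsub.trans hsubΩ)) (fun w hw => hMu w (hsub hw)) hL2p
      (by rw [hL2, show 2*(ρ/8) = ρ/4 by ring, div_mul_cancel₀ _ (by positivity)]; linarith)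
      hL1p (by nlinarith [mul_pos hL2p hρ]) (x1 := x) (y1 := y)
      (by rwa [show 2*(ρ/8) = ρ/4 by ring]) (by rwa [show 2*(ρ/8) = ρ/4 by ring]) hcon
  have hxs' := hsub (ball_subset_closedBall hxs)
  have hys' := hsub (ball_subset_closedBall hys)
  have F1 := mp_sub hμ hp ha hb hsol.1 (hsubΩ hxs') hp1 (hMu _ hxs') (hMf _ hxs') t1
  have F2 := mp_sup hμ hp ha hb hsol.2 (hsubΩ hys') hp2 (hMu _ hys') (hMf _ hys') t2
  have key := ellip_alg hlam hF (c := 4*L2+1) (by positivity) F1 F2 hT he hTe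
  have : (Lam * n * (4*L2+1) + 2*(Mu+Mf))/lam < L1 - 4*L2 - 1 := by
    rw [hL1]; nlinarith [mul_pos hL2p hρ]
  rw [div_lt_iff₀ hlam] at this
  linarith

end FIN

/-- uniform local Hölder estimates for viscosity solutions of the fully
nonlinear Multi-Phase equation with variable exponents
`G_μ(x,Du)(μu + F(D²u)) = f(x)`; the constant is independent of `μ ∈ [0,1]` and of the
moduli of continuity of `a, b, p, q, s`. -/
theorem multiphase_holder
    {n : ℕ} (hn : 2 ≤ n) (lam Lam : ℝ) (hlam : 0 < lam) (hlL : lam ≤ Lam) :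
    (∀ (Ω : Set (En n)), IsOpen Ω → Bornology.IsBounded Ω →
      ∀ F : Mat n → ℝ, UniformlyElliptic lam Lam F → F 0 = 0 →
      ∀ μ : ℝ, μ ∈ Set.Icc (0:ℝ) 1 →
      ∀ p q s : En n → ℝ, ContinuousOn p Ω → (∀ x ∈ Ω, 0 ≤ p x) →
        ContinuousOn q Ω → (∀ x ∈ Ω, 0 ≤ q x) →
        ContinuousOn s Ω → (∀ x ∈ Ω, 0 ≤ s x) →
      ∀ a b : En n → ℝ, ContinuousOn a Ω → (∀ x ∈ Ω, 0 ≤ a x) →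
        ContinuousOn b Ω → (∀ x ∈ Ω, 0 ≤ b x) →
      ∀ f : En n → ℝ, ContinuousOn f Ω → (∃ M, ∀ x ∈ Ω, |f x| ≤ M) →
      ∀ u : En n → ℝ, ContinuousOn u Ω → ViscSolOn Ω (mpOp F μ p q s a b f) u →
      ∀ β₀ ∈ Set.Ioo (0:ℝ) 1, LocallyHolderOn Ω β₀ u) ∧
    (∀ β₀ ∈ Set.Ioo (0:ℝ) 1, ∀ ρ : ℝ, 0 < ρ → ρ < 1/2 → ∀ Mu Mf : ℝ,
      ∃ c : ℝ,
        ∀ (Ω : Set (En n)), IsOpen Ω → Bornology.IsBounded Ω →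
        ∀ F : Mat n → ℝ, UniformlyElliptic lam Lam F → F 0 = 0 →
        ∀ μ : ℝ, μ ∈ Set.Icc (0:ℝ) 1 →
        ∀ p q s : En n → ℝ, ContinuousOn p Ω → (∀ x ∈ Ω, 0 ≤ p x) →
          ContinuousOn q Ω → (∀ x ∈ Ω, 0 ≤ q x) →
          ContinuousOn s Ω → (∀ x ∈ Ω, 0 ≤ s x) →
        ∀ a b : En n → ℝ, ContinuousOn a Ω → (∀ x ∈ Ω, 0 ≤ a x) →
          ContinuousOn b Ω → (∀ x ∈ Ω, 0 ≤ b x) →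
        ∀ f : En n → ℝ, ContinuousOn f Ω →
        ∀ u : En n → ℝ, ContinuousOn u Ω → ViscSolOn Ω (mpOp F μ p q s a b f) u →
        ∀ z₀ : En n, closedBall z₀ ρ ⊆ Ω →
          (∀ x ∈ ball z₀ ρ, |u x| ≤ Mu) → (∀ x ∈ ball z₀ ρ, |f x| ≤ Mf) →
          ∀ x ∈ ball z₀ (ρ/2), ∀ y ∈ ball z₀ (ρ/2),
            |u x - u y| ≤ c * ‖x - y‖ ^ β₀) := by
  have second : (∀ β₀ ∈ Set.Ioo (0:ℝ) 1, ∀ ρ : ℝ, 0 < ρ → ρ < 1/2 → ∀ Mu Mf : ℝ,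
      ∃ c : ℝ,
        ∀ (Ω : Set (En n)), IsOpen Ω → Bornology.IsBounded Ω →
        ∀ F : Mat n → ℝ, UniformlyElliptic lam Lam F → F 0 = 0 →
        ∀ μ : ℝ, μ ∈ Set.Icc (0:ℝ) 1 →
        ∀ p q s : En n → ℝ, ContinuousOn p Ω → (∀ x ∈ Ω, 0 ≤ p x) →
          ContinuousOn q Ω → (∀ x ∈ Ω, 0 ≤ q x) →
          ContinuousOn s Ω → (∀ x ∈ Ω, 0 ≤ s x) →
        ∀ a b : En n → ℝ, ContinuousOn a Ω → (∀ x ∈ Ω, 0 ≤ a x) →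
          ContinuousOn b Ω → (∀ x ∈ Ω, 0 ≤ b x) →
        ∀ f : En n → ℝ, ContinuousOn f Ω →
        ∀ u : En n → ℝ, ContinuousOn u Ω → ViscSolOn Ω (mpOp F μ p q s a b f) u →
        ∀ z₀ : En n, closedBall z₀ ρ ⊆ Ω →
          (∀ x ∈ ball z₀ ρ, |u x| ≤ Mu) → (∀ x ∈ ball z₀ ρ, |f x| ≤ Mf) →
          ∀ x ∈ ball z₀ (ρ/2), ∀ y ∈ ball z₀ (ρ/2),
            |u x - u y| ≤ c * ‖x - y‖ ^ β₀) := by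
    intro β₀ hβ ρ hρ hρ2 Mu Mf
    by_cases hneg : 0 ≤ Mu ∧ 0 ≤ Mf
    swap
    · refine ⟨0, ?_⟩
      intro Ω _ _ F _ _ μ _ p q s _ _ _ _ _ _ a b _ _ _ _ f _ u _ _ z₀ _ hMu hMf
      exfalso
      have hz : z₀ ∈ ball z₀ ρ := mem_ball_self hρ
      exact hneg ⟨(abs_nonneg _).trans (hMu _ hz), (abs_nonneg _).trans (hMf _ hz)⟩
    obtain ⟨hMu0, hMf0⟩ := hneg
    obtain ⟨L2, hL2⟩ : ∃ L2, L2 = (2*Mu+1)/(ρ/4)^2 := ⟨_, rfl⟩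
    obtain ⟨L1, hL1⟩ : ∃ L1, L1 = 4*L2*ρ + 4 + 4*L2 + 1
      + (Lam * n * (4*L2+1) + 2*(Mu+Mf))/lam + 1 := ⟨_, rfl⟩
    have hL2p : 0 < L2 := by rw [hL2]; positivity
    have hLam : 0 ≤ Lam := hlam.le.trans hlL
    have hL1p : 0 < L1 := by rw [hL1]; positivity
    refine ⟨L1 + L2 + 8*Mu/ρ, ?_⟩
    intro Ω _ _ F hF _ μ hμ p q s _ hp _ _ _ _ a b _ ha _ hb f _ u hu hsol z₀ hball hMu hMf
      x hx y hy
    have hxy : ‖x - y‖ < ρ := by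
      rw [← dist_eq_norm]
      rw [mem_ball] at hx hy
      linarith [dist_triangle_right x y z₀]
    have h0 : 0 ≤ ‖x - y‖ := norm_nonneg _
    have hpow : ‖x - y‖ ≤ ‖x - y‖ ^ β₀ := by
      rcases h0.eq_or_lt with h | h
      · rw [← h]; exact Real.rpow_nonneg le_rfl _
      · exact Real.self_le_rpow_of_le_one h0 (by linarith) hβ.2.le
    have hlin : |u x - u y| ≤ (L1 + L2 + 8*Mu/ρ) * ‖x - y‖ := by
      by_cases hc : ‖x - y‖ ≤ ρ/4
      · have hyy : y ∈ closedBall y (ρ/4) := mem_closedBall_self (by positivity)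
        have hxx : x ∈ closedBall y (ρ/4) := by rwa [mem_closedBall, dist_eq_norm]
        have i1 := lip_core hlam hlL hρ hρ2 hMu0 hMf0 hL2 hL1 hF hμ hp ha hb hu hsol hball
          hMu hMf hy hxx hyy
        have i2 := lip_core hlam hlL hρ hρ2 hMu0 hMf0 hL2 hL1 hF hμ hp ha hb hu hsol hball
          hMu hMf hy hyy hxx
        rw [norm_sub_rev y x, sub_self, norm_zero] at i2
        rw [sub_self, norm_zero] at i1
        have hsq : ‖x - y‖^2 ≤ ‖x - y‖ := by nlinarith
        have hb1 : 0 ≤ 8*Mu/ρ * ‖x - y‖ := by positivity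
        have hb2 := mul_le_mul_of_nonneg_left hsq hL2p.le
        have hb3 : 0 ≤ L1 * (‖x - y‖^2/4) := by positivity
        rw [abs_le]
        constructor <;> nlinarith
      · push Not at hc
        have hs : ball z₀ (ρ/2) ⊆ ball z₀ ρ := ball_subset_ball (by linarith)
        have j1 := abs_le.mp (hMu x (hs hx))
        have j2 := abs_le.mp (hMu y (hs hy))
        have j3 : |u x - u y| ≤ 2*Mu := by rw [abs_le]; constructor <;> linarith
        have j4 : 2*Mu ≤ 8*Mu/ρ * ‖x - y‖ := by
          have : 8*Mu/ρ * (ρ/4) = 2*Mu := by field_simp; ring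
          rw [← this]; gcongr
        have j5 : 0 ≤ (L1 + L2) * ‖x - y‖ := by positivity
        linarith
    have hcn : 0 ≤ L1 + L2 + 8*Mu/ρ := by positivity
    exact hlin.trans (mul_le_mul_of_nonneg_left hpow hcn)
  refine ⟨?_, second⟩
  intro Ω hΩ hΩb F hF hF0 μ hμ p q s hpc hp hqc hq hsc hs a b hac ha hbc hb f hfc hfM u hu hsol
    β₀ hβ x hx
  obtain ⟨Mf, hMf⟩ := hfM
  obtain ⟨ε, hε, hεΩ⟩ := Metric.isOpen_iff.mp hΩ x hx
  set ρ := min (ε/2) (1/4) with hρ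
  have hρ0 : 0 < ρ := lt_min (by linarith) (by norm_num)
  have hρ1 : ρ ≤ ε/2 := min_le_left _ _
  have hρ2 : ρ ≤ 1/4 := min_le_right _ _
  have hball : closedBall x ρ ⊆ Ω := (closedBall_subset_ball (by linarith)).trans hεΩ
  obtain ⟨Mu, hMu⟩ := (isCompact_closedBall x ρ).exists_bound_of_continuousOn (hu.mono hball)
  obtain ⟨c, hc⟩ := second β₀ hβ ρ hρ0 (by linarith) Mu Mf
  refine ⟨ρ/2, by linarith, c, ?_⟩
  intro y hy z hz
  exact hc Ω hΩ hΩb F hF hF0 μ hμ p q s hpc hp hqc hq hsc hs a b hac ha hbc hb f hfc u hu hsol x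
    hball (fun w hw => hMu w (ball_subset_closedBall hw))
    (fun w hw => hMf w (hball (ball_subset_closedBall hw))) y hy.1 z hz.1
end
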